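/- arXiv:1510.04843 — 2 statements merged into one kernel-verified Lean document; each statement's English description precedes it below -/
import Mathlib

section
/- Let π = (d_1, …, d_n) be a nonincreasing graphic sequence and s ≥ 1 an integer. If d_s ≥ s - 1 and d_{2s} ≥ s - 2, then π is potentially K_s-graphic. -/
open SimpleGraph
open scoped Classical

/-- Degree of a vertex. -/
noncomputable def deg {V : Type} (G : SimpleGraph V) (v : V) : ℕ := Nat.card (G.neighborSet v)

/-- Number of vertices of degree exactly 1 (leaves for trees/forests). -/
noncomputable def numLeaves {V : Type} (G : SimpleGraph V) : ℕ := Nat.card {v : V // deg G v = 1}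

/-- Number of connected components containing at least one edge. -/
noncomputable def numEdgeComps {V : Type} (G : SimpleGraph V) : ℕ :=
  Nat.card {c : G.ConnectedComponent // ∃ v w : V, G.Adj v w ∧ G.connectedComponentMk v = c}

/-- Maximum degree. -/
noncomputable def maxDeg {V : Type} (G : SimpleGraph V) : ℕ := sSup (Set.range (deg G))

/-- `G` and `H` pack: a bijection sends edges of `H` to non-edges of `G`. -/
def Packs {V W : Type} (G : SimpleGraph V) (H : SimpleGraph W) : Prop :=
  ∃ f : W ≃ V, ∀ x y : W, H.Adj x y → ¬ G.Adj (f x) (f y)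

/-- `G` contains a copy of `H` as a subgraph. -/
def ContainsCopy {V W : Type} (G : SimpleGraph V) (H : SimpleGraph W) : Prop :=
  ∃ f : W ↪ V, ∀ x y : W, H.Adj x y → G.Adj (f x) (f y)

/-- `G` realizes the degree sequence `π`. -/
def IsRealization {n : ℕ} (G : SimpleGraph (Fin n)) (π : Fin n → ℕ) : Prop :=
  ∀ i, deg G i = π i

/-- `π` is a graphic sequence. -/
def Graphic {n : ℕ} (π : Fin n → ℕ) : Prop :=
  ∃ G : SimpleGraph (Fin n), IsRealization G π

/-- `π` is potentially `H`-graphic. -/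
def PotentiallyGraphic {n : ℕ} {W : Type} (π : Fin n → ℕ) (H : SimpleGraph W) : Prop :=
  ∃ G : SimpleGraph (Fin n), IsRealization G π ∧ ContainsCopy G H

/-- The complementary sequence `π̄ = (n-1-d_n, …, n-1-d_1)`. -/
def compSeq {n : ℕ} (π : Fin n → ℕ) : Fin n → ℕ := fun i => n - 1 - π i.rev

/-- The potential-Ramsey number. -/
noncomputable def rpot {W₁ W₂ : Type} (H₁ : SimpleGraph W₁) (H₂ : SimpleGraph W₂) : ℕ :=
  sInf {N : ℕ | ∀ π : Fin N → ℕ, Antitone π → Graphic π →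
    PotentiallyGraphic π H₁ ∨ PotentiallyGraphic (compSeq π) H₂}

/-- The star `K_{1,t-1}` on `t` vertices, centered at vertex `0`. -/
def starGraph (t : ℕ) : SimpleGraph (Fin t) := SimpleGraph.fromRel (fun i _ => (i : ℕ) = 0)

/-- Hall's theorem for degree-constrained relations. -/
theorem exists_relation_card_eq {V : Type*} [Fintype V] (K : SimpleGraph V)
    (f : V → ℕ)
    (h : ∀ D E : Finset V, ∑ u ∈ D, f u ≤
      ∑ v ∈ E, f v + ∑ u ∈ D, (Finset.univ.filter fun v => v ∉ E ∧ K.Adj u v).card) :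
    ∃ M : V → V → Prop, (∀ u v, M u v → K.Adj u v) ∧
      (∀ u, (Finset.univ.filter fun v => M u v).card = f u) ∧
      ∀ v, (Finset.univ.filter fun u => M u v).card = f v := by
  set N : V → ℕ := fun u => (Finset.univ.filter fun v => K.Adj u v).card with hN
  have hfN : ∀ u, f u ≤ N u := fun u => by simpa [hN] using h {u} ∅
  let Cell := {c : V × V // K.Adj c.1 c.2}
  let Slot := (Σ v, Fin (f v)) ⊕ (Σ u, Fin (N u - f u))
  let P : Cell → Slot → Prop := fun c =>
    Sum.elim (fun x => x.1 = c.1.2) (fun x => x.1 = c.1.1)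
  have hcell : ∀ D E : Finset V, ((D ×ˢ E).filter fun c => K.Adj c.1 c.2).card =
      ∑ u ∈ D, (Finset.univ.filter fun v => v ∈ E ∧ K.Adj u v).card := by
    intro D E
    simp only [Finset.card_filter]
    rw [Finset.sum_product]
    refine Finset.sum_congr rfl fun u _ => ?_
    simp only [← Finset.card_filter]
    congr 1
    ext v
    simp
  have hall : ∀ X : Finset Cell,
      X.card ≤ (X.biUnion fun c => Finset.univ.filter (P c)).card := by
    intro X
    set D := X.image fun c => c.1.1
    set E := X.image fun c => c.1.2
    have h1 : X.card ≤ ∑ u ∈ D, (Finset.univ.filter fun v => v ∈ E ∧ K.Adj u v).card := by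
      rw [← hcell, ← Finset.card_image_of_injective X Subtype.val_injective]
      refine Finset.card_le_card fun c hc => ?_
      obtain ⟨x, hx, rfl⟩ := Finset.mem_image.1 hc
      simp only [Finset.mem_filter, Finset.mem_product]
      exact ⟨⟨Finset.mem_image_of_mem (fun c : Cell => c.1.1) hx,
        Finset.mem_image_of_mem (fun c : Cell => c.1.2) hx⟩, x.2⟩
    have h2 : ((E.sigma fun v => (Finset.univ : Finset (Fin (f v)))).disjSum
        (D.sigma fun u => (Finset.univ : Finset (Fin (N u - f u))))).card ≤
        (X.biUnion fun c => Finset.univ.filter (P c)).card := by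
      refine Finset.card_le_card fun x hx => ?_
      simp only [Finset.mem_biUnion, Finset.mem_filter, Finset.mem_univ, true_and]
      rcases x with x | x
      · simp only [Finset.inl_mem_disjSum, Finset.mem_sigma, Finset.mem_univ, and_true] at hx
        obtain ⟨c, hc, hx⟩ := Finset.mem_image.1 hx
        exact ⟨c, hc, hx.symm⟩
      · simp only [Finset.inr_mem_disjSum, Finset.mem_sigma, Finset.mem_univ, and_true] at hx
        obtain ⟨c, hc, hx⟩ := Finset.mem_image.1 hx
        exact ⟨c, hc, hx.symm⟩
    simp only [Finset.card_disjSum, Finset.card_sigma, Finset.card_univ, Fintype.card_fin] at h2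
    have h3 : ∑ u ∈ D, N u = ∑ u ∈ D, (Finset.univ.filter fun v => v ∈ E ∧ K.Adj u v).card +
        ∑ u ∈ D, (Finset.univ.filter fun v => v ∉ E ∧ K.Adj u v).card := by
      rw [← Finset.sum_add_distrib]
      refine Finset.sum_congr rfl fun u _ => ?_
      change (Finset.univ.filter fun v => K.Adj u v).card = _
      rw [← Finset.card_union_of_disjoint]
      · congr 1
        ext v
        simp only [Finset.mem_filter, Finset.mem_univ, true_and, Finset.mem_union]
        tauto
      · rw [Finset.disjoint_filter]
        tauto
    have h4 : ∑ u ∈ D, (N u - f u) + ∑ u ∈ D, f u = ∑ u ∈ D, N u := by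
      rw [← Finset.sum_add_distrib]
      exact Finset.sum_congr rfl fun u _ => Nat.sub_add_cancel (hfN u)
    have h5 := h D E
    omega
  obtain ⟨φ, hφ, hφP⟩ := (Finset.all_card_le_biUnion_card_iff_exists_injective _).1 hall
  have hφP : ∀ c, P c (φ c) := fun c => by simpa using hφP c
  have hcard : Fintype.card Cell = Fintype.card Slot := by
    have h1 : Fintype.card Cell = ∑ u, N u := by
      rw [Fintype.card_subtype]
      simpa using hcell Finset.univ Finset.univ
    have h4 : ∑ u, (N u - f u) + ∑ u, f u = ∑ u, N u := by
      rw [← Finset.sum_add_distrib]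
      exact Finset.sum_congr rfl fun u _ => Nat.sub_add_cancel (hfN u)
    simp only [Slot, Fintype.card_sum, Fintype.card_sigma, Fintype.card_fin]
    omega
  have hsurj : Function.Surjective φ :=
    ((Fintype.bijective_iff_injective_and_card φ).2 ⟨hφ, hcard⟩).2
  have hrow : ∀ u, (Finset.univ.filter fun v => ∃ h : K.Adj u v, (φ ⟨(u, v), h⟩).isRight).card =
      N u - f u := by
    intro u
    rw [← Fintype.card_fin (N u - f u), ← Finset.card_univ]
    symm
    have key : ∀ k : Fin (N u - f u), ∃ v, ∃ h : K.Adj u v, φ ⟨(u, v), h⟩ = Sum.inr ⟨u, k⟩ := by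
      intro k
      obtain ⟨⟨⟨u', v⟩, hc⟩, hk⟩ := hsurj (Sum.inr ⟨u, k⟩)
      have := hφP ⟨(u', v), hc⟩
      rw [hk] at this
      have : u = u' := this
      subst this
      exact ⟨v, hc, hk⟩
    choose g hg hgk using key
    refine Finset.card_bij (fun k _ => g k) ?_ ?_ ?_
    · intro k _
      simp only [Finset.mem_filter, Finset.mem_univ, true_and]
      exact ⟨hg k, by rw [hgk]; rfl⟩
    · intro k _ k' _ hkk
      have : (Sum.inr ⟨u, k⟩ : Slot) = Sum.inr ⟨u, k'⟩ := by
        rw [← hgk k, ← hgk k']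
        congr 3
      simpa using this
    · intro v hv
      simp only [Finset.mem_filter, Finset.mem_univ, true_and] at hv
      obtain ⟨hv, hr⟩ := hv
      obtain ⟨⟨u', k⟩, hk⟩ := Sum.isRight_iff.1 hr
      have := hφP ⟨(u, v), hv⟩
      rw [hk] at this
      have : u' = u := this
      subst this
      refine ⟨k, Finset.mem_univ _, ?_⟩
      have := hφ ((hgk k).trans hk.symm)
      exact congrArg (fun c : Cell => c.1.2) this
  refine ⟨fun u v => ∃ h : K.Adj u v, (φ ⟨(u, v), h⟩).isLeft, fun u v h => h.1, ?_, ?_⟩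
  · intro u
    have h1 := hrow u
    have h2 : N u = (Finset.univ.filter fun v => ∃ h : K.Adj u v, (φ ⟨(u, v), h⟩).isLeft).card +
        (Finset.univ.filter fun v => ∃ h : K.Adj u v, (φ ⟨(u, v), h⟩).isRight).card := by
      change (Finset.univ.filter fun v => K.Adj u v).card = _
      rw [← Finset.card_union_of_disjoint]
      · congr 1
        ext v
        simp only [Finset.mem_filter, Finset.mem_univ, true_and, Finset.mem_union]
        constructor
        · intro h
          rcases hx : φ ⟨(u, v), h⟩ with x | x
          · exact Or.inl ⟨h, by rw [hx]; rfl⟩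
          · exact Or.inr ⟨h, by rw [hx]; rfl⟩
        · rintro (h | h) <;> exact h.1
      · rw [Finset.disjoint_filter]
        rintro v - ⟨h, h1⟩ ⟨_, h2⟩
        obtain ⟨x, hx⟩ := Sum.isLeft_iff.1 h1
        rw [hx] at h2
        simp at h2
    have := hfN u
    have h3 : (Finset.univ.filter fun v => ∃ h : K.Adj u v, (φ ⟨(u, v), h⟩).isLeft).card = f u := by
      omega
    convert h3
  · intro v
    rw [← Fintype.card_fin (f v), ← Finset.card_univ]
    symm
    have key : ∀ k : Fin (f v), ∃ u, ∃ h : K.Adj u v, φ ⟨(u, v), h⟩ = Sum.inl ⟨v, k⟩ := by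
      intro k
      obtain ⟨⟨⟨u, v'⟩, hc⟩, hk⟩ := hsurj (Sum.inl ⟨v, k⟩)
      have := hφP ⟨(u, v'), hc⟩
      rw [hk] at this
      have : v = v' := this
      subst this
      exact ⟨u, hc, hk⟩
    choose g hg hgk using key
    refine Finset.card_bij (fun k _ => g k) ?_ ?_ ?_
    · intro k _
      simp only [Finset.mem_filter, Finset.mem_univ, true_and]
      exact ⟨hg k, by rw [hgk]; rfl⟩
    · intro k _ k' _ hkk
      have : (Sum.inl ⟨v, k⟩ : Slot) = Sum.inl ⟨v, k'⟩ := by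
        rw [← hgk k, ← hgk k']
        congr 3
      simpa using this
    · intro u hu
      simp only [Finset.mem_filter, Finset.mem_univ, true_and] at hu
      obtain ⟨hu, hr⟩ := hu
      obtain ⟨⟨v', k⟩, hk⟩ := Sum.isLeft_iff.1 hr
      have := hφP ⟨(u, v), hu⟩
      rw [hk] at this
      have : v' = v := this
      subst this
      refine ⟨k, Finset.mem_univ _, ?_⟩
      have := hφ ((hgk k).trans hk.symm)
      exact congrArg (fun c : Cell => c.1.1) this

/-- The weight `m` takes values in `{0, 1, 2}`, is supported on the edges of `K`, and has
weighted degree `2 * f v` at every vertex `v`. -/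
structure IsHalfFactor {V : Type*} [Fintype V] (K : SimpleGraph V) (f : V → ℕ)
    (m : Sym2 V → ℤ) : Prop where
  values : ∀ e, m e = 0 ∨ m e = 1 ∨ m e = 2
  support : ∀ u v, m s(u, v) ≠ 0 → K.Adj u v
  row : ∀ u, ∑ v, m s(u, v) = 2 * f u

/-- The indicator weight of the pair `s(a, b)`. -/
noncomputable def pairWeight {V : Type*} (a b : V) (e : Sym2 V) : ℤ := if e = s(a, b) then 1 else 0

theorem sum_pairWeight {V : Type*} [Fintype V] {a b : V} (hab : a ≠ b) (u : V) :
    ∑ v, pairWeight a b s(u, v) = (if u = a then 1 else 0) + (if u = b then 1 else 0) := by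
  unfold pairWeight
  by_cases ha : u = a
  · subst ha
    have : ∀ v, s(u, v) = s(u, b) ↔ v = b := fun v => by simp; grind
    simp [this, hab]
  · by_cases hb : u = b
    · subst hb
      have : ∀ v, s(u, v) = s(a, u) ↔ v = a := fun v => by
        rw [Sym2.eq_swap (a := a)]; simp; grind
      simp [this, ha]
    · have : ∀ v, s(u, v) ≠ s(a, b) := fun v => by simp [ha, hb]
      simp [this, ha, hb]

theorem exists_isHalfFactor {V : Type*} [Fintype V] {K : SimpleGraph V} {f : V → ℕ}
    {M : V → V → Prop} (hK : ∀ u v, M u v → K.Adj u v)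
    (hrow : ∀ u, (Finset.univ.filter fun v => M u v).card = f u)
    (hcol : ∀ v, (Finset.univ.filter fun u => M u v).card = f v) :
    ∃ m, IsHalfFactor K f m := by
  let c : V → V → ℤ := fun u v => (if M u v then 1 else 0) + (if M v u then 1 else 0)
  refine ⟨Sym2.lift ⟨c, fun u v => add_comm _ _⟩, ?_, ?_, ?_⟩
  · intro e
    induction e with
    | _ u v =>
      simp only [Sym2.lift_mk, c]
      split_ifs <;> simp
  · intro u v h
    by_contra hn
    apply h
    have h1 : ¬ M u v := fun h => hn (hK _ _ h)
    have h2 : ¬ M v u := fun h => hn (hK _ _ h).symm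
    simp [c, h1, h2]
  · intro u
    simp only [Sym2.lift_mk, c, Finset.sum_add_distrib]
    have h1 : ∑ v, (if M u v then (1 : ℤ) else 0) = f u := by
      rw [← hrow u]; simp
    have h2 : ∑ v, (if M v u then (1 : ℤ) else 0) = f u := by
      rw [← hcol u]; simp
    rw [h1, h2]; ring

/-- The pairs of weight one. -/
noncomputable def halfEdges {V : Type*} [Fintype V] (m : Sym2 V → ℤ) : Finset (Sym2 V) :=
  Finset.univ.filter fun e => m e = 1

namespace IsHalfFactor

variable {V : Type*} [Fintype V] {K : SimpleGraph V} {f : V → ℕ} {m : Sym2 V → ℤ}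

theorem adj (hm : IsHalfFactor K f m) {u v : V} (h : m s(u, v) = 1) : K.Adj u v :=
  hm.support u v (by omega)

theorem exists_ne (hm : IsHalfFactor K f m) {v w : V} (h : m s(v, w) = 1) :
    ∃ u, u ≠ w ∧ m s(v, u) = 1 := by
  by_contra! hn
  have h1 := hm.row v
  rw [← Finset.add_sum_erase _ _ (Finset.mem_univ w), h] at h1
  have h2 : (2 : ℤ) ∣ ∑ u ∈ Finset.univ.erase w, m s(v, u) := by
    refine Finset.dvd_sum fun u hu => ?_
    have := hn u (Finset.ne_of_mem_erase hu)
    rcases hm.values s(v, u) with h | h | h <;> simp_all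
  omega

theorem reduce_path (hm : IsHalfFactor K f m) {u v w x : V} (huv : m s(u, v) = 1)
    (hvw : m s(v, w) = 1) (hwx : m s(w, x) = 1) (huw : u ≠ w) (hvx : v ≠ x)
    (hux : K.Adj u x) :
    ∃ m', IsHalfFactor K f m' ∧ (halfEdges m').card < (halfEdges m).card := by
  have huv' := (hm.adj huv).ne
  have hvw' := (hm.adj hvw).ne
  have hwx' := (hm.adj hwx).ne
  have hux' := hux.ne
  have e1 : s(u, v) ≠ s(v, w) := by simp; tauto
  have e2 : s(u, v) ≠ s(w, x) := by simp; tauto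
  have e3 : s(u, v) ≠ s(u, x) := by simp; tauto
  have e4 : s(v, w) ≠ s(w, x) := by simp; tauto
  have e5 : s(v, w) ≠ s(u, x) := by simp; tauto
  have e6 : s(w, x) ≠ s(u, x) := by simp; tauto
  obtain ⟨ε, hε, hεx⟩ : ∃ ε : ℤ, (ε = 1 ∨ ε = -1) ∧
      (m s(u, x) + ε = 0 ∨ m s(u, x) + ε = 1 ∨ m s(u, x) + ε = 2) := by
    rcases hm.values s(u, x) with h | h | h
    · exact ⟨1, by simp [h]⟩
    · exact ⟨1, by simp [h]⟩
    · exact ⟨-1, by simp [h]⟩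
  let m' : Sym2 V → ℤ := fun e => m e + ε * (pairWeight u x e - pairWeight u v e +
    pairWeight v w e - pairWeight w x e)
  have k1 : m' s(u, v) = m s(u, v) - ε := by
    simp only [m', pairWeight, if_neg e1, if_neg e2, if_neg e3, if_true]; ring
  have k2 : m' s(v, w) = m s(v, w) + ε := by
    simp only [m', pairWeight, if_neg e1.symm, if_neg e4, if_neg e5, if_true]; ring
  have k3 : m' s(w, x) = m s(w, x) - ε := by
    simp only [m', pairWeight, if_neg e2.symm, if_neg e4.symm, if_neg e6, if_true]; ring
  have k4 : m' s(u, x) = m s(u, x) + ε := by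
    simp only [m', pairWeight, if_neg e3.symm, if_neg e5.symm, if_neg e6.symm, if_true]; ring
  have k5 : ∀ e, e ≠ s(u, v) → e ≠ s(v, w) → e ≠ s(w, x) → e ≠ s(u, x) → m' e = m e := by
    intro e h1 h2 h3 h4
    simp only [m', pairWeight, if_neg h1, if_neg h2, if_neg h3, if_neg h4]; ring
  refine ⟨m', ⟨?_, ?_, ?_⟩, ?_⟩
  · intro e
    by_cases h1 : e = s(u, v)
    · subst h1; omega
    by_cases h2 : e = s(v, w)
    · subst h2; omega
    by_cases h3 : e = s(w, x)
    · subst h3; omega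
    by_cases h4 : e = s(u, x)
    · subst h4; omega
    rw [k5 e h1 h2 h3 h4]
    exact hm.values e
  · intro p q h
    by_cases h1 : s(p, q) = s(u, v)
    · exact hm.support p q (by rw [h1]; omega)
    by_cases h2 : s(p, q) = s(v, w)
    · exact hm.support p q (by rw [h2]; omega)
    by_cases h3 : s(p, q) = s(w, x)
    · exact hm.support p q (by rw [h3]; omega)
    by_cases h4 : s(p, q) = s(u, x)
    · rw [← mem_edgeSet, h4]; exact hux
    exact hm.support p q (by rwa [← k5 _ h1 h2 h3 h4])
  · intro p
    simp only [m', Finset.sum_add_distrib, ← Finset.mul_sum, Finset.sum_sub_distrib,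
      sum_pairWeight huv', sum_pairWeight hvw', sum_pairWeight hwx', sum_pairWeight hux', hm.row]
    ring
  · have hsub : halfEdges m' ⊆ insert s(u, x) (((halfEdges m).erase s(u, v)).erase s(v, w)) := by
      intro e he
      simp only [halfEdges, Finset.mem_filter, Finset.mem_univ, true_and, Finset.mem_insert,
        Finset.mem_erase] at he ⊢
      by_cases h4 : e = s(u, x)
      · exact Or.inl h4
      have h1 : e ≠ s(u, v) := by rintro rfl; omega
      have h2 : e ≠ s(v, w) := by rintro rfl; omega
      have h3 : e ≠ s(w, x) := by rintro rfl; omega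
      exact Or.inr ⟨h2, h1, by rwa [← k5 e h1 h2 h3 h4]⟩
    have m1 : s(u, v) ∈ halfEdges m := by simp [halfEdges, huv]
    have m2 : s(v, w) ∈ (halfEdges m).erase s(u, v) := by
      simp only [Finset.mem_erase, halfEdges, Finset.mem_filter, Finset.mem_univ, true_and]
      exact ⟨e1.symm, hvw⟩
    have c1 := Finset.card_erase_add_one m1
    have c2 := Finset.card_erase_add_one m2
    have c3 := (Finset.card_le_card hsub).trans (Finset.card_insert_le _ _)
    omega

theorem reduce_triangles (hm : IsHalfFactor K f m) {a b c a' b' c' : V}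
    (hab : m s(a, b) = 1) (hac : m s(a, c) = 1) (hbc : m s(b, c) = 1)
    (hab' : m s(a', b') = 1) (hac' : m s(a', c') = 1) (hbc' : m s(b', c') = 1)
    (ha : a' ≠ a ∧ a' ≠ b ∧ a' ≠ c) (hb : b' ≠ a ∧ b' ≠ b ∧ b' ≠ c)
    (hc : c' ≠ a ∧ c' ≠ b ∧ c' ≠ c) (haa : K.Adj a a') (hne : m s(a, a') ≠ 1) :
    ∃ m', IsHalfFactor K f m' ∧ (halfEdges m').card < (halfEdges m).card := by
  have n1 := (hm.adj hab).ne
  have n2 := (hm.adj hac).ne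
  have n3 := (hm.adj hbc).ne
  have n1' := (hm.adj hab').ne
  have n2' := (hm.adj hac').ne
  have n3' := (hm.adj hbc').ne
  obtain ⟨ha1, ha2, ha3⟩ := ha
  obtain ⟨hb1, hb2, hb3⟩ := hb
  obtain ⟨hc1, hc2, hc3⟩ := hc
  obtain ⟨ε, hε, hεx⟩ : ∃ ε : ℤ, (ε = 1 ∨ ε = -1) ∧
      (m s(a, a') + 2 * ε = 0 ∨ m s(a, a') + 2 * ε = 2) := by
    rcases hm.values s(a, a') with h | h | h
    · exact ⟨1, by simp [h]⟩
    · exact absurd h hne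
    · exact ⟨-1, by simp [h]⟩
  let m' : Sym2 V → ℤ := fun e => m e + ε * (2 * pairWeight a a' e - pairWeight a b e -
    pairWeight a c e + pairWeight b c e - pairWeight a' b' e - pairWeight a' c' e +
    pairWeight b' c' e)
  have k0 : m' s(a, a') = m s(a, a') + 2 * ε := by
    have : pairWeight a b s(a, a') = 0 ∧ pairWeight a c s(a, a') = 0 ∧
      pairWeight b c s(a, a') = 0 ∧ pairWeight a' b' s(a, a') = 0 ∧
      pairWeight a' c' s(a, a') = 0 ∧ pairWeight b' c' s(a, a') = 0 ∧
      pairWeight a a' s(a, a') = 1 := by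
      simp only [pairWeight, Sym2.eq_iff]; grind
    simp only [m', this]; ring
  have k1 : m' s(a, b) = m s(a, b) - ε ∧ m' s(a, c) = m s(a, c) - ε ∧
      m' s(b, c) = m s(b, c) + ε ∧ m' s(a', b') = m s(a', b') - ε ∧
      m' s(a', c') = m s(a', c') - ε ∧ m' s(b', c') = m s(b', c') + ε := by
    simp only [m', pairWeight, Sym2.eq_iff]; grind
  obtain ⟨k1, k2, k3, k4, k5, k6⟩ := k1
  have k7 : ∀ e, e ≠ s(a, a') → e ≠ s(a, b) → e ≠ s(a, c) → e ≠ s(b, c) → e ≠ s(a', b') →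
      e ≠ s(a', c') → e ≠ s(b', c') → m' e = m e := by
    intro e h0 h1 h2 h3 h4 h5 h6
    simp only [m', pairWeight, if_neg h0, if_neg h1, if_neg h2, if_neg h3, if_neg h4, if_neg h5,
      if_neg h6]
    ring
  have hcases : ∀ e, (e = s(a, a') ∧ m' e ≠ 1 ∧ (m' e = 0 ∨ m' e = 2)) ∨
      (m e = 1 ∧ (m' e = 0 ∨ m' e = 2)) ∨
      (m' e = m e ∧ e ≠ s(a, b)) := by
    intro e
    by_cases h0 : e = s(a, a')
    · subst h0; left; refine ⟨rfl, ?_⟩; omega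
    right
    by_cases h1 : e = s(a, b)
    · subst h1; left; omega
    by_cases h2 : e = s(a, c)
    · subst h2; left; omega
    by_cases h3 : e = s(b, c)
    · subst h3; left; omega
    by_cases h4 : e = s(a', b')
    · subst h4; left; omega
    by_cases h5 : e = s(a', c')
    · subst h5; left; omega
    by_cases h6 : e = s(b', c')
    · subst h6; left; omega
    exact Or.inr ⟨k7 e h0 h1 h2 h3 h4 h5 h6, h1⟩
  refine ⟨m', ⟨?_, ?_, ?_⟩, ?_⟩
  · intro e
    have := hm.values e
    rcases hcases e with h | h | h <;> omega
  · intro p q h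
    rcases hcases s(p, q) with h' | h' | h'
    · rw [← mem_edgeSet, h'.1]; exact haa
    · exact hm.adj h'.1
    · exact hm.support p q (by rwa [← h'.1])
  · intro p
    simp only [m', Finset.sum_add_distrib, ← Finset.mul_sum, Finset.sum_sub_distrib,
      sum_pairWeight n1, sum_pairWeight n2, sum_pairWeight n3, sum_pairWeight n1',
      sum_pairWeight n2', sum_pairWeight n3', sum_pairWeight haa.ne, hm.row]
    ring
  · refine Finset.card_lt_card ⟨?_, fun hsub => ?_⟩
    · intro e he
      simp only [halfEdges, Finset.mem_filter, Finset.mem_univ, true_and] at he ⊢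
      rcases hcases e with h | h | h <;> omega
    · have : s(a, b) ∈ halfEdges m' := hsub (by simp [halfEdges, hab])
      simp only [halfEdges, Finset.mem_filter, Finset.mem_univ, true_and] at this
      omega

end IsHalfFactor

/-- If the non-edges of `K` all lie inside an independent set `A`, and the degrees `f` have even
sum, then a half-integral `f`-factor of `K` can be turned into an `f`-factor. -/
theorem IsHalfFactor.exists_factor {V : Type*} [Fintype V] {K : SimpleGraph V} {f : V → ℕ}
    {A : Set V} (hK : ∀ u v, K.Adj u v ↔ u ≠ v ∧ ¬ (u ∈ A ∧ v ∈ A)) (hf : Even (∑ v, f v))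
    {m : Sym2 V → ℤ} (hm : IsHalfFactor K f m) :
    ∃ H ≤ K, ∀ u, (Finset.univ.filter fun v => H.Adj u v).card = f u := by
  induction hk : (halfEdges m).card using Nat.strong_induction_on generalizing m with
  | _ k ih =>
  subst hk
  by_cases hred : ∃ m', IsHalfFactor K f m' ∧ (halfEdges m').card < (halfEdges m).card
  · obtain ⟨m', hm', hlt⟩ := hred
    exact ih _ hlt hm' rfl
  have sym : ∀ {u v : V}, m s(u, v) = 1 → m s(v, u) = 1 := fun h => by rwa [Sym2.eq_swap]
  have path : ∀ {u v w x : V}, m s(u, v) = 1 → m s(v, w) = 1 → m s(w, x) = 1 → u ≠ w → v ≠ x →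
      ¬ K.Adj u x := fun h1 h2 h3 h4 h5 h6 => hred (hm.reduce_path h1 h2 h3 h4 h5 h6)
  have notAdj : ∀ {u x : V}, u ≠ x → ¬ K.Adj u x → u ∈ A ∧ x ∈ A := fun h1 h2 => by
    rw [hK] at h2; tauto
  have hadj : ∀ {u v : V}, m s(u, v) = 1 → u ≠ v ∧ ¬ (u ∈ A ∧ v ∈ A) := fun h =>
    (hK _ _).1 (hm.adj h)
  have triangle : ∀ {v w : V}, m s(v, w) = 1 → ∃ u, m s(u, v) = 1 ∧ m s(u, w) = 1 := by
    intro v w hvw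
    obtain ⟨u, huw, hvu⟩ := hm.exists_ne hvw
    obtain ⟨x, hxv, hwx⟩ := hm.exists_ne (sym hvw)
    by_cases hux : u = x
    · subst hux
      exact ⟨u, sym hvu, sym hwx⟩
    obtain ⟨huA, hxA⟩ := notAdj hux (path (sym hvu) hvw hwx huw hxv.symm)
    have hwA : w ∉ A := fun h => (hadj hwx).2 ⟨h, hxA⟩
    obtain ⟨t, htv, hut⟩ := hm.exists_ne (sym hvu)
    by_cases htw : t = w
    · subst htw
      exact ⟨u, sym hvu, hut⟩
    · exact absurd (notAdj htw (path (sym hut) (sym hvu) hvw htv huw)).2 hwA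
  have isolated : ∀ {a b c z : V}, m s(a, b) = 1 → m s(a, c) = 1 → m s(b, c) = 1 →
      m s(a, z) = 1 → z = b ∨ z = c := by
    intro a b c z hab hac hbc haz
    by_contra! hz
    by_cases hc : c ∈ A
    · have hb : b ∉ A := fun h => (hadj hbc).2 ⟨h, hc⟩
      exact hb (notAdj hz.1 (path (sym haz) hac (sym hbc) hz.2 (hadj hab).1)).2
    · exact hc (notAdj hz.2 (path (sym haz) hab hbc hz.1 (hadj hac).1)).2
  by_cases hne : ∃ v w, m s(v, w) = 1
  · exfalso
    obtain ⟨a, b, haA, hab⟩ : ∃ a b, a ∉ A ∧ m s(a, b) = 1 := by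
      obtain ⟨v, w, hvw⟩ := hne
      by_cases hv : v ∈ A
      · exact ⟨w, v, fun h => (hadj hvw).2 ⟨hv, h⟩, sym hvw⟩
      · exact ⟨v, w, hv, hvw⟩
    obtain ⟨c, hca, hcb⟩ := triangle hab
    have iso : ∀ {x z : V}, (x = a ∨ x = b ∨ x = c) → m s(x, z) = 1 →
        z ≠ x ∧ (z = a ∨ z = b ∨ z = c) := by
      rintro x z (rfl | rfl | rfl) h
      · have := isolated hab (sym hca) (sym hcb) h
        exact ⟨(hadj h).1.symm, by tauto⟩
      · have := isolated (sym hab) (sym hcb) (sym hca) h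
        exact ⟨(hadj h).1.symm, by tauto⟩
      · have := isolated hca hcb hab h
        exact ⟨(hadj h).1.symm, by tauto⟩
    by_cases hout : ∃ p q, m s(p, q) = 1 ∧ ¬ (p = a ∨ p = b ∨ p = c)
    · obtain ⟨p, q, hpq, hp⟩ := hout
      obtain ⟨r, hrp, hrq⟩ := triangle hpq
      have hq : ¬ (q = a ∨ q = b ∨ q = c) := fun h => hp (iso h (sym hpq)).2
      have hr : ¬ (r = a ∨ r = b ∨ r = c) := fun h => hp (iso h hrp).2
      push Not at hp hq hr
      refine hred (hm.reduce_triangles hab (sym hca) (sym hcb) hpq (sym hrp) (sym hrq) hp hq hr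
        ((hK _ _).2 ⟨hp.1.symm, fun h => haA h.1⟩) fun h => ?_)
      have := (iso (Or.inl rfl) h).2
      tauto
    · push Not at hout
      let S : SimpleGraph V := ⟨fun u v => m s(u, v) = 2, ⟨fun u v h => by
        rwa [Sym2.eq_swap]⟩, ⟨fun u h => (hm.support u u (by omega)).ne rfl⟩⟩
      have hab' := (hadj hab).1
      have hca' := (hadj hca).1
      have hcb' := (hadj hcb).1
      let T : Finset V := {a, b, c}
      have hT : T.card = 3 := Finset.card_eq_three.2 ⟨a, b, c, hab', hca'.symm, hcb'.symm, rfl⟩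
      have hone : ∀ u v, m s(u, v) = 1 ↔ u ∈ T ∧ v ∈ T.erase u := by
        intro u v
        simp only [T, Finset.mem_erase, Finset.mem_insert, Finset.mem_singleton]
        constructor
        · intro h
          have := hout u v h
          exact ⟨by tauto, iso (by tauto) h⟩
        · rintro ⟨h1, h2, h3⟩
          have e1 := sym hab
          have e2 := sym hca
          have e3 := sym hcb
          rcases h1 with rfl | rfl | rfl <;> rcases h3 with rfl | rfl | rfl <;>
            first | assumption | exact absurd rfl h2
      have hdeg : ∀ u, f u = S.degree u + if u ∈ T then 1 else 0 := by
        intro u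
        have h1 : ∀ v, m s(u, v) = 2 * (if S.Adj u v then 1 else 0) +
            if u ∈ T ∧ v ∈ T.erase u then 1 else 0 := by
          intro v
          simp only [← hone u v, S]
          rcases hm.values s(u, v) with h | h | h <;> simp [h]
        have h2 := hm.row u
        rw [Finset.sum_congr rfl fun v _ => h1 v, Finset.sum_add_distrib, ← Finset.mul_sum,
          Finset.sum_boole, Finset.sum_boole] at h2
        have h3 : (Finset.univ.filter fun v => S.Adj u v).card = S.degree u := by
          rw [← card_neighborFinset_eq_degree, neighborFinset_eq_filter]
        have h4 : (Finset.univ.filter fun v => u ∈ T ∧ v ∈ T.erase u).card =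
            2 * if u ∈ T then 1 else 0 := by
          by_cases hu : u ∈ T
          · simp [hu, -Finset.mem_erase, hT]
          · simp [hu]
        rw [h3, h4] at h2
        push_cast at h2
        split_ifs at h2 ⊢ <;> omega
      have hsum : ∑ u, f u = 2 * S.edgeFinset.card + 3 := by
        rw [← S.sum_degrees_eq_twice_card_edges, Finset.sum_congr rfl fun u _ => hdeg u,
          Finset.sum_add_distrib]
        simp [hT]
      rw [hsum] at hf
      obtain ⟨k, hk⟩ := hf
      omega
  · push Not at hne
    refine ⟨⟨fun u v => m s(u, v) = 2, ⟨fun u v h => by rwa [Sym2.eq_swap]⟩,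
      ⟨fun u h => (hm.support u u (by omega)).ne rfl⟩⟩, fun u v h => ?_, fun u => ?_⟩
    · have h : m s(u, v) = 2 := h
      exact hm.support u v (by omega)
    · have h1 : ∀ v, m s(u, v) = 2 * (if m s(u, v) = 2 then 1 else 0) := by
        intro v
        have := hne u v
        rcases hm.values s(u, v) with h | h | h <;> simp_all
      have h2 := hm.row u
      rw [Finset.sum_congr rfl fun v _ => h1 v, ← Finset.mul_sum, Finset.sum_boole] at h2
      have h3 : (Finset.univ.filter fun v => m s(u, v) = 2).card = f u := by
        omega
      convert h3

theorem hall_of_disjoint {V : Type*} [Fintype V] {K : SimpleGraph V} {f : V → ℕ}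
    (h : ∀ D E : Finset V, Disjoint D E → ∑ u ∈ D, f u ≤
      ∑ v ∈ E, f v + ∑ u ∈ D, (Finset.univ.filter fun v => v ∉ E ∧ K.Adj u v).card)
    (D E : Finset V) : ∑ u ∈ D, f u ≤
      ∑ v ∈ E, f v + ∑ u ∈ D, (Finset.univ.filter fun v => v ∉ E ∧ K.Adj u v).card := by
  have h1 := h (D \ E) (E \ D) (Finset.disjoint_left.2 fun x hx hx' => by simp_all)
  have h2 : ∑ u ∈ D \ E, (Finset.univ.filter fun v => v ∉ E \ D ∧ K.Adj u v).card ≤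
      ∑ u ∈ D \ E, (Finset.univ.filter fun v => v ∉ E ∧ K.Adj u v).card +
      ∑ u ∈ D \ E, ((D ∩ E).filter fun v => K.Adj u v).card := by
    rw [← Finset.sum_add_distrib]
    refine Finset.sum_le_sum fun u _ => ?_
    refine (Finset.card_le_card fun v hv => ?_).trans (Finset.card_union_le _ _)
    simp only [Finset.mem_filter, Finset.mem_univ, true_and, Finset.mem_union, Finset.mem_inter,
      Finset.mem_sdiff] at hv ⊢
    tauto
  have h3 : ∑ u ∈ D \ E, ((D ∩ E).filter fun v => K.Adj u v).card ≤
      ∑ u ∈ D ∩ E, (Finset.univ.filter fun v => v ∉ E ∧ K.Adj u v).card := by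
    have := Finset.sum_card_bipartiteAbove_eq_sum_card_bipartiteBelow (s := D \ E) (t := D ∩ E)
      K.Adj
    unfold Finset.bipartiteAbove Finset.bipartiteBelow at this
    rw [this]
    refine Finset.sum_le_sum fun u _ => Finset.card_le_card fun v hv => ?_
    simp only [Finset.mem_filter, Finset.mem_univ, true_and, Finset.mem_sdiff] at hv ⊢
    exact ⟨hv.1.2, hv.2.symm⟩
  have h4 := Finset.sum_inter_add_sum_sdiff D E f
  have h5 := Finset.sum_inter_add_sum_sdiff E D f
  have h6 := Finset.sum_inter_add_sum_sdiff D E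
    fun u => (Finset.univ.filter fun v => v ∉ E ∧ K.Adj u v).card
  rw [Finset.inter_comm] at h5
  omega

theorem hall_arith {p δ o σ s ν k T : ℤ} (hp : 0 ≤ p) (ho : 0 ≤ o) (hν : 0 ≤ ν) (hδ : ν < δ)
    (hσ : p + σ ≤ s) (hk0 : 0 ≤ k) (hk : s ≤ k + δ + o) (hT0 : 0 ≤ T) (hT : s - 2 - p ≤ T) :
    (σ - δ) * (δ - ν) ≤ k * T + δ * o ∨
      (o = 0 ∧ σ = δ + 1 ∧ p + σ = s ∧ (σ - δ) * (δ - ν) ≤ k * T + δ * o + 1) := by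
  have hkT := mul_nonneg hk0 hT0
  have hδo : 0 ≤ δ * o := mul_nonneg (by omega) ho
  rcases le_or_gt σ δ with h | h
  · left; nlinarith
  rcases le_or_gt (p + δ) (s - 2) with h' | h'
  · left
    have e1 : k * δ ≤ k * T := mul_le_mul_of_nonneg_left (by omega) hk0
    have e2 : (σ - δ) * (δ - ν) ≤ (s - δ) * δ :=
      mul_le_mul (by omega) (by omega) (by omega) (by omega)
    have e3 : (s - δ) * δ ≤ (k + o) * δ := mul_le_mul_of_nonneg_right (by omega) (by omega)
    linarith
  have hσδ : σ - δ = 1 := by omega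
  rw [hσδ]
  rcases ho.eq_or_lt with h0 | h0
  · right
    refine ⟨h0.symm, by omega, by omega, ?_⟩
    have : 1 * T ≤ k * T := mul_le_mul_of_nonneg_right (by omega) hT0
    rw [← h0]
    linarith
  · left
    have : δ * 1 ≤ δ * o := mul_le_mul_of_nonneg_left (by omega) (by omega)
    linarith

theorem hall_condition {V : Type*} [Fintype V] {G K : SimpleGraph V} {f : V → ℕ} {A B : Finset V}
    {ν : ℕ} (hK : ∀ u v, K.Adj u v ↔ u ≠ v ∧ ¬ (u ∈ A ∧ v ∈ A)) (hAB : Disjoint A B)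
    (hB : A.card ≤ B.card) (hfA : ∀ a ∈ A, f a + A.card = G.degree a + 1)
    (hfR : ∀ r ∉ A, f r = G.degree r) (hνA : ∀ a ∈ A, ν ≤ f a)
    (hνR : ∀ r ∉ A, f r + 1 ≤ A.card + ν) (hfB : ∀ b ∈ B, A.card ≤ f b + 2)
    (hf : Even (∑ v, f v)) (D E : Finset V) : ∑ u ∈ D, f u ≤
      ∑ v ∈ E, f v + ∑ u ∈ D, (Finset.univ.filter fun v => v ∉ E ∧ K.Adj u v).card := by
  revert D E
  refine hall_of_disjoint fun D E hDE => ?_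
  have hle : ∀ u, f u ≤ (Finset.univ.filter fun v => G.Adj u v ∧ K.Adj u v).card := by
    intro u
    by_cases hu : u ∈ A
    · have h1 : G.degree u ≤ (Finset.univ.filter fun v => G.Adj u v ∧ K.Adj u v).card +
          (A.erase u).card := by
        rw [← card_neighborFinset_eq_degree]
        refine (Finset.card_le_card fun v hv => ?_).trans (Finset.card_union_le _ _)
        rw [mem_neighborFinset] at hv
        have := hv.ne
        simp only [Finset.mem_union, Finset.mem_filter, Finset.mem_univ, true_and, hK,
          Finset.mem_erase]
        tauto
      have h2 := Finset.card_erase_add_one hu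
      have h3 := hfA u hu
      omega
    · rw [hfR u hu, ← card_neighborFinset_eq_degree]
      refine Finset.card_le_card fun v hv => ?_
      rw [mem_neighborFinset] at hv
      have := hv.ne
      simp only [Finset.mem_filter, Finset.mem_univ, true_and, hK]
      tauto
  rcases le_or_gt (D \ A).card ν with hδ | hδ
  · have h1 : ∑ u ∈ D, f u ≤
        ∑ u ∈ D, (Finset.univ.filter fun v => v ∉ E ∧ K.Adj u v).card +
        ∑ u ∈ D, (E.filter fun v => G.Adj u v ∧ K.Adj u v).card := by
      rw [← Finset.sum_add_distrib]
      refine Finset.sum_le_sum fun u _ => (hle u).trans ?_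
      refine (Finset.card_le_card fun v hv => ?_).trans (Finset.card_union_le _ _)
      simp only [Finset.mem_filter, Finset.mem_univ, true_and, Finset.mem_union] at hv ⊢
      tauto
    have h2 := Finset.sum_card_bipartiteAbove_eq_sum_card_bipartiteBelow (s := D) (t := E)
      fun u v => G.Adj u v ∧ K.Adj u v
    simp only [Finset.bipartiteAbove, Finset.bipartiteBelow] at h2
    have h3 : ∑ v ∈ E, (D.filter fun u => G.Adj u v ∧ K.Adj u v).card ≤ ∑ v ∈ E, f v := by
      refine Finset.sum_le_sum fun v _ => ?_
      by_cases hv : v ∈ A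
      · refine (Finset.card_le_card fun u hu => ?_).trans (hδ.trans (hνA v hv))
        simp only [Finset.mem_filter, hK, Finset.mem_sdiff] at hu ⊢
        tauto
      · rw [hfR v hv, ← card_neighborFinset_eq_degree]
        refine Finset.card_le_card fun u hu => ?_
        rw [mem_neighborFinset]
        exact (Finset.mem_filter.1 hu).2.1.symm
    omega
  · set p := (D ∩ A).card with hp
    set δ := (D \ A).card with hδ'
    set σ := (E ∩ A).card with hσ
    set O := Finset.univ.filter fun v => v ∉ A ∧ v ∉ D ∧ v ∉ E with hO
    have cA : p + σ ≤ A.card := by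
      rw [hp, hσ, ← Finset.card_union_of_disjoint]
      · exact Finset.card_le_card fun v => by simp; tauto
      · exact hDE.mono Finset.inter_subset_left Finset.inter_subset_left
    have cB : B.card ≤ (E ∩ B).card + δ + O.card := by
      refine (Finset.card_le_card fun v hv => ?_).trans ((Finset.card_union_le _ _).trans
        (Nat.add_le_add_right (Finset.card_union_le _ _) _))
      have := Finset.disjoint_right.1 hAB hv
      simp only [hO, Finset.mem_union, Finset.mem_inter, Finset.mem_sdiff, Finset.mem_filter,
        Finset.mem_univ, true_and]
      tauto
    have hal : ∑ u ∈ D, (Finset.univ.filter fun v => v ∉ E ∧ K.Adj u v).card + δ =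
        δ * (δ + O.card + (A \ E).card) + p * (δ + O.card) := by
      have hDO : Disjoint (D \ A) O := Finset.disjoint_left.2 fun v hv hv' => by
        simp only [hO, Finset.mem_sdiff, Finset.mem_filter] at hv hv'; tauto
      have hDOA : Disjoint (D \ A ∪ O) (A \ E) := Finset.disjoint_left.2 fun v hv hv' => by
        simp only [hO, Finset.mem_union, Finset.mem_sdiff, Finset.mem_filter] at hv hv'; tauto
      rw [← Finset.sum_inter_add_sum_sdiff D A, add_comm (∑ u ∈ D ∩ A, _), add_right_comm]
      congr 1
      · suffices h : ∀ u ∈ D \ A, (Finset.univ.filter fun v => v ∉ E ∧ K.Adj u v).card + 1 =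
            δ + O.card + (A \ E).card by
          have h1 := Finset.sum_congr rfl h
          rwa [Finset.sum_add_distrib, ← Finset.card_eq_sum_ones, Finset.sum_const,
            smul_eq_mul] at h1
        intro u hu
        rw [← Finset.card_union_of_disjoint hDO, ← Finset.card_union_of_disjoint hDOA]
        have hu' := Finset.mem_sdiff.1 hu
        rw [← Finset.card_erase_add_one (a := u) (s := D \ A ∪ O ∪ A \ E) (by simp [hu'])]
        congr 2
        ext v
        have : v ∈ D → v ∉ E := fun h => Finset.disjoint_left.1 hDE h
        simp only [hK, hO, Finset.mem_erase, Finset.mem_union, Finset.mem_sdiff,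
          Finset.mem_filter, Finset.mem_univ, true_and, ne_comm (a := v)]
        tauto
      · rw [← smul_eq_mul, hp, ← Finset.sum_const]
        refine Finset.sum_congr rfl fun u hu => ?_
        have hu' := Finset.mem_inter.1 hu
        rw [hδ', ← Finset.card_union_of_disjoint hDO]
        congr 1
        ext v
        have : v ∈ D → v ∉ E := fun h => Finset.disjoint_left.1 hDE h
        have : v ∉ A → u ≠ v := by rintro h rfl; exact h hu'.2
        simp only [hK, hO, Finset.mem_union, Finset.mem_sdiff,
          Finset.mem_filter, Finset.mem_univ, true_and]
        tauto
    have cAE : (A \ E).card + σ = A.card := by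
      rw [hσ, Finset.inter_comm]; exact Finset.card_sdiff_add_card_inter A E
    have hDA : ∑ u ∈ D ∩ A, f u ≤ p * (δ + O.card) + ∑ v ∈ E \ A, min p (f v) := by
      have h1 : ∑ u ∈ D ∩ A, f u ≤ ∑ u ∈ D ∩ A, ((δ + O.card) +
          ((E \ A).filter fun v => G.Adj u v).card) := by
        refine Finset.sum_le_sum fun u hu => (hle u).trans ?_
        refine (Finset.card_le_card fun v hv => ?_).trans ((Finset.card_union_le _ _).trans
          (Nat.add_le_add_right (Finset.card_union_le _ _) _))
        have hu' := Finset.mem_inter.1 hu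
        simp only [hO, hK, Finset.mem_union, Finset.mem_sdiff, Finset.mem_filter,
          Finset.mem_univ, true_and] at hv ⊢
        tauto
      rw [Finset.sum_add_distrib, Finset.sum_const, smul_eq_mul] at h1
      have h2 := Finset.sum_card_bipartiteAbove_eq_sum_card_bipartiteBelow (s := D ∩ A)
        (t := E \ A) G.Adj
      unfold Finset.bipartiteAbove Finset.bipartiteBelow at h2
      rw [h2] at h1
      refine h1.trans (Nat.add_le_add_left (Finset.sum_le_sum fun v hv => le_min ?_ ?_) _)
      · exact Finset.card_le_card (Finset.filter_subset _ _)
      · rw [hfR v (Finset.mem_sdiff.1 hv).2, ← card_neighborFinset_eq_degree]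
        refine Finset.card_le_card fun u hu => ?_
        rw [mem_neighborFinset]
        exact (Finset.mem_filter.1 hu).2.symm
    have hDR : ∑ u ∈ D \ A, f u + δ ≤ δ * (A.card + ν) := by
      rw [← smul_eq_mul, hδ', ← Finset.sum_const, Finset.card_eq_sum_ones (D \ A),
        ← Finset.sum_add_distrib]
      exact Finset.sum_le_sum fun u hu => hνR u (Finset.mem_sdiff.1 hu).2
    have hEA : σ * ν ≤ ∑ v ∈ E ∩ A, f v := by
      rw [← smul_eq_mul, hσ, ← Finset.sum_const]
      exact Finset.sum_le_sum fun u hu => hνA u (Finset.mem_inter.1 hu).2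
    have hER : (E ∩ B).card * (A.card - 2 - p) + ∑ v ∈ E \ A, min p (f v) ≤
        ∑ v ∈ E \ A, f v := by
      have h1 : ∑ v ∈ E ∩ B, (A.card - 2 - p) ≤ ∑ v ∈ E \ A, (f v - min p (f v)) := by
        refine (Finset.sum_le_sum fun v hv => ?_).trans
          (Finset.sum_le_sum_of_subset (s := E ∩ B) fun v hv => ?_)
        · have := hfB v (Finset.mem_inter.1 hv).2
          omega
        · have hv' := Finset.mem_inter.1 hv
          exact Finset.mem_sdiff.2 ⟨hv'.1, Finset.disjoint_right.1 hAB hv'.2⟩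
      have h2 : ∑ v ∈ E \ A, (f v - min p (f v)) + ∑ v ∈ E \ A, min p (f v) =
          ∑ v ∈ E \ A, f v := by
        rw [← Finset.sum_add_distrib]
        exact Finset.sum_congr rfl fun v _ => Nat.sub_add_cancel (min_le_right _ _)
      rw [Finset.sum_const, smul_eq_mul] at h1
      omega
    have hD := Finset.sum_inter_add_sum_sdiff D A f
    have hE := Finset.sum_inter_add_sum_sdiff E A f
    have hcase := hall_arith (p := p) (δ := δ) (o := O.card) (σ := σ) (s := A.card) (ν := ν)
      (k := (E ∩ B).card) (T := (A.card - 2 - p : ℕ)) (by omega) (by omega) (by omega) (by omega)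
      (by omega) (by omega) (by omega) (by omega) (by omega)
    generalize ∑ u ∈ D, (Finset.univ.filter fun v => v ∉ E ∧ K.Adj u v).card = al at hal ⊢
    generalize (A.card - 2 - p : ℕ) = T at hER hcase
    have cAE' : ((A \ E).card : ℤ) = A.card - σ := by omega
    zify at hal hDA hDR hEA hER hD hE ⊢
    rw [cAE'] at hal
    rcases hcase with h | ⟨ho, hσδ, hpσ, h⟩
    · linarith
    · have huniv : D ∪ E = Finset.univ := by
        have hO0 : O = ∅ := Finset.card_eq_zero.1 (by omega)
        have hA : D ∩ A ∪ E ∩ A = A := by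
          refine Finset.eq_of_subset_of_card_le (fun v => by simp; tauto) ?_
          rw [Finset.card_union_of_disjoint
            (hDE.mono Finset.inter_subset_left Finset.inter_subset_left)]
          omega
        refine Finset.eq_univ_of_forall fun v => ?_
        by_cases hv : v ∈ A
        · rw [← hA] at hv
          simp only [Finset.mem_union, Finset.mem_inter] at hv ⊢
          tauto
        · by_contra hn
          have : v ∈ O := by
            simp only [hO, Finset.mem_union, Finset.mem_filter, Finset.mem_univ, true_and]
              at hn ⊢
            tauto
          simp [hO0] at this
      have heven : Even al := by
        have h1 : (al : ℤ) = 2 * (p * δ) + δ * (δ - 1) := by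
          rw [ho] at hal
          have : (A.card : ℤ) = p + σ := hpσ.symm
          rw [this] at hal
          linarith
        have h2 := Int.even_mul_pred_self (δ : ℤ)
        have h3 : Even (al : ℤ) := h1 ▸ (even_two_mul _).add h2
        exact_mod_cast h3
      have hsum : ∑ v ∈ D, f v + ∑ v ∈ E, f v = ∑ v, f v := by
        rw [← huniv, Finset.sum_union hDE]
      have hnear : ∑ v ∈ D, f v ≤ ∑ v ∈ E, f v + al + 1 := by
        zify
        linarith
      obtain ⟨x, hx⟩ := hf
      obtain ⟨y, hy⟩ := heven
      zify at hnear hx hy hsum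
      omega

theorem exists_isClique_of_degree_eq {V : Type*} [Fintype V] {G : SimpleGraph V} {A B : Finset V}
    {d : ℕ} (hAB : Disjoint A B) (hB : A.card ≤ B.card) (hd : A.card ≤ d + 1)
    (hA : ∀ a ∈ A, d ≤ G.degree a) (hR : ∀ r ∉ A, G.degree r ≤ d)
    (hdB : ∀ b ∈ B, A.card ≤ G.degree b + 2) :
    ∃ G' : SimpleGraph V, (∀ v, G'.degree v = G.degree v) ∧ G'.IsClique A := by
  let K : SimpleGraph V := SimpleGraph.fromRel fun u v => ¬ (u ∈ A ∧ v ∈ A)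
  have hK : ∀ u v, K.Adj u v ↔ u ≠ v ∧ ¬ (u ∈ A ∧ v ∈ A) := fun u v => by
    simp only [K, SimpleGraph.fromRel_adj]; tauto
  let f : V → ℕ := fun v => G.degree v - if v ∈ A then A.card - 1 else 0
  have hfA : ∀ a ∈ A, f a + A.card = G.degree a + 1 := fun a ha => by
    have := hA a ha
    have := Finset.card_pos.2 ⟨a, ha⟩
    simp only [f, if_pos ha]
    omega
  have hfR : ∀ r ∉ A, f r = G.degree r := fun r hr => by simp [f, hr]
  have hf : Even (∑ v, f v) := by
    have h1 : ∑ v, f v + A.card * A.card = ∑ v, G.degree v + A.card := by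
      have h2 : ∀ v, f v + (if v ∈ A then A.card else 0) = G.degree v + if v ∈ A then 1 else 0 := by
        intro v
        split_ifs with hv
        · exact hfA v hv
        · rw [hfR v hv]
      have h3 := Finset.sum_congr rfl fun v (_ : v ∈ Finset.univ) => h2 v
      simpa [Finset.sum_add_distrib] using h3
    rw [G.sum_degrees_eq_twice_card_edges] at h1
    obtain ⟨x, hx⟩ := Nat.even_mul_succ_self A.card
    rw [mul_add_one] at hx
    generalize A.card * A.card = q at h1 hx
    exact ⟨G.edgeFinset.card + A.card - x, by omega⟩
  obtain ⟨M, hMK, hrow, hcol⟩ := exists_relation_card_eq K f <|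
    hall_condition (ν := d + 1 - A.card) hK hAB hB hfA hfR
      (fun a ha => by have := hfA a ha; have := hA a ha; omega)
      (fun r hr => by have := hfR r hr; have := hR r hr; omega)
      (fun b hb => by rw [hfR b (Finset.disjoint_right.1 hAB hb)]; exact hdB b hb) hf
  obtain ⟨m, hm⟩ := exists_isHalfFactor hMK hrow hcol
  obtain ⟨H, hHK, hH⟩ := hm.exists_factor (A := (A : Set V)) (by simpa using hK) hf
  refine ⟨⟨fun u v => H.Adj u v ∨ (u ≠ v ∧ u ∈ A ∧ v ∈ A),
    ⟨fun u v h => h.imp H.adj_symm fun h => ⟨h.1.symm, h.2.2, h.2.1⟩⟩,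
    ⟨fun u h => h.elim H.irrefl fun h => h.1 rfl⟩⟩, fun u => ?_,
    fun u hu v hv huv => Or.inr ⟨huv, hu, hv⟩⟩
  rw [← card_neighborFinset_eq_degree, neighborFinset_eq_filter]
  by_cases hu : u ∈ A
  · have h1 : (Finset.univ.filter fun v => H.Adj u v ∨ (u ≠ v ∧ u ∈ A ∧ v ∈ A)) =
        (Finset.univ.filter fun v => H.Adj u v) ∪ A.erase u := by
      ext v
      simp [hu, eq_comm]
    have h2 : Disjoint (Finset.univ.filter fun v => H.Adj u v) (A.erase u) :=
      Finset.disjoint_left.2 fun v hv hv' =>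
        ((hK u v).1 (hHK (Finset.mem_filter.1 hv).2)).2 ⟨hu, Finset.mem_of_mem_erase hv'⟩
    have h3 := Finset.card_union_of_disjoint h2
    rw [← h1, hH u] at h3
    have h4 := Finset.card_erase_add_one hu
    have h5 := hfA u hu
    have h6 : (Finset.univ.filter fun v => H.Adj u v ∨ (u ≠ v ∧ u ∈ A ∧ v ∈ A)).card =
      G.degree u := by omega
    convert h6
  · rw [← hfR u hu, ← hH u]
    congr 1
    ext v
    simp [hu]

theorem deg_eq_degree {V : Type} [Fintype V] (G : SimpleGraph V) (v : V) :
    deg G v = G.degree v := by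
  rw [deg, Nat.card_eq_fintype_card, card_neighborSet_eq_degree]

/-- Yin–Li (i): if d_s ≥ s-1 and d_{2s} ≥ s-2 then π is potentially K_s-graphic. -/
theorem yin_li_i {n s : ℕ} (hs : 1 ≤ s) (hn : 2 * s ≤ n)
    (π : Fin n → ℕ) (hmono : Antitone π) (hg : Graphic π)
    (h1 : s - 1 ≤ π ⟨s - 1, by omega⟩) (h2 : s - 2 ≤ π ⟨2 * s - 1, by omega⟩) :
    PotentiallyGraphic π (⊤ : SimpleGraph (Fin s)) := by
  obtain ⟨G, hG⟩ := hg
  have hdeg : ∀ i, G.degree i = π i := fun i => by rw [← deg_eq_degree, hG]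
  let A : Finset (Fin n) := Finset.univ.filter fun i => i.val < s
  let B : Finset (Fin n) := Finset.univ.filter fun i => s ≤ i.val ∧ i.val < 2 * s
  have hA : A.card = s := by
    have : A = Finset.univ.map (Fin.castLEEmb (by omega : s ≤ n)) := by
      ext i
      simp only [A, Finset.mem_filter, Finset.mem_univ, true_and, Finset.mem_map]
      exact ⟨fun h => ⟨⟨i, h⟩, rfl⟩, by rintro ⟨j, rfl⟩; exact j.2⟩
    rw [this, Finset.card_map, Finset.card_fin]
  have hB : B.card = s := by
    have : B = Finset.univ.map ((Fin.natAddEmb s).trans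
        (Fin.castLEEmb (by omega : s + s ≤ n))) := by
      ext i
      simp only [B, Finset.mem_filter, Finset.mem_univ, true_and, Finset.mem_map]
      constructor
      · rintro ⟨h, h'⟩
        exact ⟨⟨i - s, by omega⟩, Fin.ext (by simp; omega)⟩
      · rintro ⟨j, rfl⟩
        simp; omega
    rw [this, Finset.card_map, Finset.card_fin]
  obtain ⟨G', hG', hclique⟩ := exists_isClique_of_degree_eq (G := G) (A := A) (B := B)
    (d := π ⟨s - 1, by omega⟩)
    (Finset.disjoint_left.2 fun i hi hi' => by simp [A, B] at hi hi'; omega)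
    (by omega) (by omega)
    (fun i hi => by
      rw [hdeg]
      refine hmono (Fin.le_def.2 ?_)
      simp [A] at hi ⊢; omega)
    (fun i hi => by
      rw [hdeg]
      refine hmono (Fin.le_def.2 ?_)
      simp [A] at hi ⊢; omega)
    (fun i hi => by
      have : π ⟨2 * s - 1, by omega⟩ ≤ π i := hmono (Fin.le_def.2 (by simp [B] at hi ⊢; omega))
      rw [hdeg]
      omega)
  refine ⟨G', fun i => by rw [deg_eq_degree, hG', hdeg], Fin.castLEEmb (by omega), ?_⟩
  intro x y hxy
  refine hclique (by simp [A]) (by simp [A]) fun h => hxy.ne ?_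
  exact (Fin.castLEEmb _).injective h
end

section
/- Let π = (d_1, …, d_n) be a nonincreasing graphic sequence and s ≥ 1. If d_s ≥ s - 1 and d_i ≥ 2s - 2 - i for all 1 ≤ i ≤ s - 1, then π is potentially K_s-graphic. -/
open SimpleGraph
open scoped Classical

/-- The adjacency relation of `G` after replacing the edges `bc`, `da` with `ab`, `cd`. -/
def SwitchAdj {V : Type} (G : SimpleGraph V) (a b c d x y : V) : Prop :=
  (G.Adj x y ∧ ¬ (x = b ∧ y = c) ∧ ¬ (x = c ∧ y = b) ∧ ¬ (x = d ∧ y = a) ∧ ¬ (x = a ∧ y = d)) ∨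
    (x = a ∧ y = b) ∨ (x = b ∧ y = a) ∨ (x = c ∧ y = d) ∨ (x = d ∧ y = c)

theorem SwitchAdj.symm {V : Type} {G : SimpleGraph V} {a b c d x y : V}
    (h : SwitchAdj G a b c d x y) : SwitchAdj G a b c d y x := by
  rcases h with ⟨h, h1, h2, h3, h4⟩ | h | h | h | h
  · exact Or.inl ⟨h.symm, fun e => h2 e.symm, fun e => h1 e.symm, fun e => h4 e.symm,
      fun e => h3 e.symm⟩
  · exact Or.inr (Or.inr (Or.inl h.symm))
  · exact Or.inr (Or.inl h.symm)
  · exact Or.inr (Or.inr (Or.inr (Or.inr h.symm)))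
  · exact Or.inr (Or.inr (Or.inr (Or.inl h.symm)))

theorem not_switchAdj_self {V : Type} {G : SimpleGraph V} {a b c d : V} (hab : a ≠ b)
    (hcd : c ≠ d) (x : V) : ¬ SwitchAdj G a b c d x x := by
  rintro (h | ⟨rfl, h⟩ | ⟨rfl, h⟩ | ⟨rfl, h⟩ | ⟨rfl, h⟩)
  · exact G.loopless.irrefl x h.1
  · exact hab h
  · exact hab h.symm
  · exact hcd h
  · exact hcd h.symm

theorem deg_eq_card_filter {V : Type} [Fintype V] (G : SimpleGraph V) (v : V) :
    deg G v = (Finset.univ.filter (G.Adj v)).card := by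
  rw [deg, Nat.card_eq_fintype_card, Fintype.card_subtype]
  rfl

/-- Alternating 4-cycles may be switched without changing any degree. -/
theorem exists_switch {V : Type} [Fintype V] (G : SimpleGraph V) {a b c d : V}
    (hab : a ≠ b) (hcd : c ≠ d) (nab : ¬ G.Adj a b) (hbc : G.Adj b c) (ncd : ¬ G.Adj c d)
    (hda : G.Adj d a) : ∃ H : SimpleGraph V, (∀ x, deg H x = deg G x) ∧
      ∀ x y, H.Adj x y ↔
        (G.Adj x y ∧ ¬ (x = b ∧ y = c) ∧ ¬ (x = c ∧ y = b) ∧ ¬ (x = d ∧ y = a) ∧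
          ¬ (x = a ∧ y = d)) ∨
        (x = a ∧ y = b) ∨ (x = b ∧ y = a) ∨ (x = c ∧ y = d) ∨ (x = d ∧ y = c) := by
  have hac : a ≠ c := by rintro rfl; exact nab hbc.symm
  have hbd : b ≠ d := by rintro rfl; exact nab hda.symm
  have hbc' := hbc.ne
  have hda' := hda.ne
  let H : SimpleGraph V :=
    { Adj := SwitchAdj G a b c d
      symm := ⟨fun _ _ h => h.symm⟩
      loopless := ⟨not_switchAdj_self hab hcd⟩ }
  have hadj : ∀ x y, H.Adj x y ↔ SwitchAdj G a b c d x y := fun _ _ => Iff.rfl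
  refine ⟨H, fun x => ?_, hadj⟩
  have key : ∀ p q : V, ¬ G.Adj x p → G.Adj x q →
      (∀ y, H.Adj x y ↔ y = p ∨ (y ≠ q ∧ G.Adj x y)) → deg H x = deg G x := by
    intro p q hp hq h
    have e : Finset.univ.filter (H.Adj x) =
        insert p ((Finset.univ.filter (G.Adj x)).erase q) := by
      ext y
      simp [h]
    rw [deg_eq_card_filter, deg_eq_card_filter, e, Finset.card_insert_of_notMem (by simp [hp]),
      Finset.card_erase_add_one (by simp [hq])]
  simp only [hadj, SwitchAdj] at key
  by_cases hxa : x = a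
  · refine key b d (hxa ▸ nab) (hxa ▸ hda.symm) fun y => ?_
    clear key
    grind
  by_cases hxb : x = b
  · refine key a c (hxb ▸ fun h => nab h.symm) (hxb ▸ hbc) fun y => ?_
    clear key
    grind
  by_cases hxc : x = c
  · refine key d b (hxc ▸ ncd) (hxc ▸ hbc.symm) fun y => ?_
    clear key
    grind
  by_cases hxd : x = d
  · refine key c a (hxd ▸ fun h => ncd h.symm) (hxd ▸ hda) fun y => ?_
    clear key
    grind
  have e : ∀ y, H.Adj x y ↔ G.Adj x y := by
    intro y
    rw [hadj, SwitchAdj]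
    tauto
  simp only [deg_eq_card_filter, e]

/-- Edges from `q` to `M` may be moved to `z`, in exchange for edges from `z` to `T`. -/
theorem exists_transfer {V : Type} [Fintype V] {q z : V} (hqz : q ≠ z) (M : Finset V) :
    ∀ (G : SimpleGraph V) (T : Finset V), M.card ≤ T.card →
      (∀ x ∈ M, x ≠ z ∧ G.Adj q x ∧ ¬ G.Adj z x) → (∀ y ∈ T, y ≠ q ∧ G.Adj z y ∧ ¬ G.Adj q y) →
      ∃ H : SimpleGraph V, (∀ x, deg H x = deg G x) ∧ (∀ x ∈ M, H.Adj z x) ∧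
        (∀ x, x ∉ M → x ∉ T → (H.Adj z x ↔ G.Adj z x)) ∧
        ∀ x y, x ≠ q → x ≠ z → y ≠ q → y ≠ z → (H.Adj x y ↔ G.Adj x y) := by
  induction M using Finset.induction_on with
  | empty => exact fun G T _ _ _ => ⟨G, by simp⟩
  | insert x M hx ih =>
    intro G T hMT hM hT
    rw [Finset.card_insert_of_notMem hx] at hMT
    obtain ⟨y, hy⟩ : T.Nonempty := Finset.card_pos.mp (by omega)
    have hyT := hT y hy
    have hxM := hM x (Finset.mem_insert_self _ _)
    obtain ⟨G₁, hdeg₁, hadj₁⟩ := exists_switch G (a := z) (b := x) (c := q) (d := y)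
      hxM.1.symm hyT.1.symm hxM.2.2 hxM.2.1.symm hyT.2.2 hyT.2.1.symm
    have hxq : x ≠ q := hxM.2.1.ne'
    have hyz : y ≠ z := hyT.2.1.ne'
    obtain ⟨H, hdeg, hMH, hzH, hH⟩ := ih G₁ (T.erase y)
      (by rw [Finset.card_erase_of_mem hy]; omega)
      (by
        intro p hp
        have := hM p (Finset.mem_insert_of_mem hp)
        have : p ≠ x := by rintro rfl; exact hx hp
        rw [hadj₁, hadj₁]
        grind)
      (by
        intro p hp
        have := hT p (Finset.mem_of_mem_erase hp)
        have : p ≠ y := Finset.ne_of_mem_erase hp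
        rw [hadj₁, hadj₁]
        grind)
    refine ⟨H, fun p => (hdeg p).trans (hdeg₁ p), ?_, ?_, ?_⟩
    · intro p hp
      rcases Finset.mem_insert.mp hp with rfl | hp
      · have : p ∉ T := fun h => hxM.2.2 (hT p h).2.1
        rw [hzH p hx (by simp [this]), hadj₁]
        grind
      · exact hMH p hp
    · intro p hp hpT
      rw [hzH p (fun h => hp (Finset.mem_insert_of_mem h))
        (fun h => hpT (Finset.mem_of_mem_erase h)), hadj₁]
      have : p ≠ x := by rintro rfl; exact hp (Finset.mem_insert_self _ _)
      have : p ≠ y := by rintro rfl; exact hpT hy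
      grind
    · intro p r hp hp' hr hr'
      rw [hH p r hp hp' hr hr', hadj₁]
      grind

/-- In a clique, a vertex may be exchanged for one of at least the same degree. -/
theorem exists_clique_exchange {V : Type} [Fintype V] (G : SimpleGraph V) (Q : Finset V)
    (hQ : G.IsClique (Q : Set V)) {q z : V} (hq : q ∈ Q) (hz : z ∉ Q) (hle : deg G q ≤ deg G z) :
    ∃ H : SimpleGraph V, (∀ x, deg H x = deg G x) ∧
      H.IsClique (insert z (Q.erase q) : Finset V) := by
  have hqz : q ≠ z := by rintro rfl; exact hz hq
  set A : Finset V := (Finset.univ.filter (G.Adj q)).erase z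
  set B : Finset V := (Finset.univ.filter (G.Adj z)).erase q
  have hAB : A.card ≤ B.card := by
    rw [deg_eq_card_filter, deg_eq_card_filter] at hle
    by_cases h : G.Adj q z
    · rw [Finset.card_erase_of_mem (by simpa using h),
        Finset.card_erase_of_mem (by simpa using h.symm)]
      omega
    · have h' : ¬ G.Adj z q := fun h' => h h'.symm
      simpa only [A, B, Finset.erase_eq_of_notMem, Finset.mem_filter, Finset.mem_univ, true_and,
        h, h', not_false_eq_true] using hle
  have hdiff : (A \ B).card ≤ (B \ A).card := by
    have h1 := Finset.card_sdiff_add_card_inter A B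
    have h2 := Finset.card_sdiff_add_card_inter B A
    rw [Finset.inter_comm] at h2
    omega
  obtain ⟨H, hdeg, hM, hT, hH⟩ := exists_transfer hqz (A \ B) G (B \ A) hdiff
    (by
      intro x hx
      simp only [A, B, Finset.mem_sdiff, Finset.mem_erase, Finset.mem_filter, Finset.mem_univ,
        true_and] at hx
      have := hx.1.2.ne'
      tauto)
    (by
      intro x hx
      simp only [A, B, Finset.mem_sdiff, Finset.mem_erase, Finset.mem_filter, Finset.mem_univ,
        true_and] at hx
      have := hx.1.2.ne'
      tauto)
  have hzK : ∀ x ∈ Q, x ≠ q → H.Adj z x := by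
    intro x hx hxq
    have hqx : G.Adj q x := hQ hq hx hxq.symm
    have hxz : x ≠ z := by rintro rfl; exact hz hx
    by_cases h : G.Adj z x
    · rw [hT x (by simp [A, B, h, hxq]) (by simp [A, B, hxz, hqx])]
      exact h
    · exact hM x (by simp [A, B, h, hqx, hxz])
  refine ⟨H, hdeg, ?_⟩
  intro x hx y hy hxy
  simp only [Finset.coe_insert, Finset.coe_erase, Set.mem_insert_iff, Set.mem_sdiff,
    Finset.mem_coe, Set.mem_singleton_iff] at hx hy
  rcases hx with rfl | hx <;> rcases hy with rfl | hy
  · exact absurd rfl hxy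
  · exact hzK y hy.1 hy.2
  · exact (hzK x hx.1 hx.2).symm
  · exact (hH x y hx.2 (by rintro rfl; exact hz hx.1) hy.2 (by rintro rfl; exact hz hy.1)).mpr
      (hQ hx.1 hy.1 hxy)

/-- The vertices of `Q` that are not adjacent to `v`. -/
noncomputable def missing {V : Type} (G : SimpleGraph V) (v : V) (Q : Finset V) : Finset V :=
  Q.filter fun q => ¬ G.Adj v q

/-- `Q` is a clique, and no graph with the same degrees in which `Q` is a clique has more edges
between `v` and `Q`. -/
def CliqueOptimal {V : Type} (G : SimpleGraph V) (v : V) (Q : Finset V) : Prop :=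
  G.IsClique (Q : Set V) ∧ ∀ H : SimpleGraph V, (∀ x, deg H x = deg G x) →
    H.IsClique (Q : Set V) → (missing G v Q).card ≤ (missing H v Q).card

theorem CliqueOptimal.of_deg_eq {V : Type} {G H : SimpleGraph V} {v : V} {Q : Finset V}
    (hG : CliqueOptimal G v Q) (hdeg : ∀ x, deg H x = deg G x) (hQ : H.IsClique (Q : Set V))
    (hcard : (missing H v Q).card ≤ (missing G v Q).card) : CliqueOptimal H v Q :=
  ⟨hQ, fun K hK hKQ => hcard.trans (hG.2 K (fun x => (hK x).trans (hdeg x)) hKQ)⟩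

theorem CliqueOptimal.adj_of_adj {V : Type} [Fintype V] {G : SimpleGraph V} {v : V} {Q : Finset V}
    (hG : CliqueOptimal G v Q) (hv : v ∉ Q) {w c u : V} (hw : w ∈ Q) (hvw : ¬ G.Adj v w)
    (hc : c ∉ Q) (hwc : G.Adj w c) (hu : u ∉ Q) (hvu : G.Adj v u) (hcu : c ≠ u) :
    G.Adj c u := by
  by_contra h
  have hvw' : v ≠ w := by rintro rfl; exact hv hw
  obtain ⟨H, hdeg, hadj⟩ := exists_switch G hvw' hcu hvw hwc h hvu.symm
  refine absurd (hG.2 H hdeg ?_) (not_le.mpr (Finset.card_lt_card ?_))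
  · intro x hx y hy hxy
    have := hG.1 hx hy hxy
    rw [Finset.mem_coe] at hx hy
    rw [hadj]
    grind
  · refine Finset.ssubset_iff_of_subset ?_ |>.mpr ⟨w, ?_, ?_⟩
    · intro x
      simp only [missing, Finset.mem_filter, hadj]
      grind
    · simp [missing, hw, hvw]
    · simp [missing, hadj]

/-- The neighbours of `v` outside `Q` that are adjacent to all other such neighbours. -/
noncomputable def coreNbrs {V : Type} [Fintype V] (G : SimpleGraph V) (v : V) (Q : Finset V) :
    Finset V :=
  Finset.univ.filter fun c => c ∉ Q ∧ G.Adj v c ∧ ∀ u, u ∉ Q → G.Adj v u → c ≠ u → G.Adj c u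

theorem mem_coreNbrs {V : Type} [Fintype V] {G : SimpleGraph V} {v : V} {Q : Finset V} {c : V} :
    c ∈ coreNbrs G v Q ↔
      c ∉ Q ∧ G.Adj v c ∧ ∀ u, u ∉ Q → G.Adj v u → c ≠ u → G.Adj c u := by
  simp [coreNbrs]

/-- If the neighbours of `v` outside `Q` are not a clique, then the neighbours outside `Q` of a
vertex of `Q` not adjacent to `v` belong to the core. -/
theorem CliqueOptimal.mem_coreNbrs {V : Type} [Fintype V] {G : SimpleGraph V} {v : V}
    {Q : Finset V} (hG : CliqueOptimal G v Q) (hv : v ∉ Q) {a b : V} (ha : a ∉ Q)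
    (hva : G.Adj v a) (hb : b ∉ Q) (hvb : G.Adj v b) (hab : a ≠ b) (nab : ¬ G.Adj a b)
    {w c : V} (hw : w ∈ Q) (hvw : ¬ G.Adj v w) (hc : c ∉ Q) (hwc : G.Adj w c) :
    c ∈ coreNbrs G v Q := by
  have key : ∀ u, u ∉ Q → G.Adj v u → c ≠ u → G.Adj c u := fun u hu hvu hcu =>
    hG.adj_of_adj hv hw hvw hc hwc hu hvu hcu
  refine _root_.mem_coreNbrs.mpr ⟨hc, ?_, key⟩
  by_contra hvc
  have hcv : c ≠ v := by rintro rfl; exact hvw hwc.symm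
  have hcb : c ≠ b := by rintro rfl; exact hvc hvb
  have hwv : w ≠ v := by rintro rfl; exact hv hw
  obtain ⟨H, hdeg, hadj⟩ := exists_switch G (a := c) (b := v) (c := a) (d := b) hcv hab
    (fun h => hvc h.symm) hva nab (key b hb hvb hcb).symm
  have hvb' := hvb.ne
  have hva' := hva.ne
  have hH : CliqueOptimal H v Q := by
    refine hG.of_deg_eq hdeg ?_ (Finset.card_le_card ?_)
    · intro x hx y hy hxy
      have := hG.1 hx hy hxy
      rw [Finset.mem_coe] at hx hy
      rw [hadj]
      grind
    · intro x
      simp only [missing, Finset.mem_filter, hadj]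
      grind
  have h := hH.adj_of_adj hv hw (c := c) (u := b) (by rw [hadj]; grind) hc
    (by rw [hadj]; grind) hb (by rw [hadj]; grind) hcb
  rw [hadj] at h
  grind

theorem CliqueOptimal.mem_coreNbrs_of_adj {V : Type} [Fintype V] {G : SimpleGraph V} {v : V}
    {Q : Finset V} (hG : CliqueOptimal G v Q) (hv : v ∉ Q) {a b : V} (ha : a ∉ Q)
    (hva : G.Adj v a) (hb : b ∉ Q) (hvb : G.Adj v b) (hab : a ≠ b) (nab : ¬ G.Adj a b)
    {w c q r : V} (hw : w ∈ Q) (hvw : ¬ G.Adj v w) (hc : c ∉ Q) (hwc : G.Adj w c)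
    (hq : q ∈ Q) (hqc : ¬ G.Adj q c) (hr : r ∉ Q) (hrv : r ≠ v) (hqr : G.Adj q r) :
    r ∈ coreNbrs G v Q := by
  by_cases hvq : G.Adj v q
  swap
  · exact hG.mem_coreNbrs hv ha hva hb hvb hab nab hq hvq hr hqr
  have hwv : v ≠ w := by rintro rfl; exact hv hw
  have hcq : c ≠ q := by rintro rfl; exact hc hq
  have hcv : c ≠ v := by rintro rfl; exact hvw hwc.symm
  have hwq : w ≠ q := by rintro rfl; exact hvw hvq
  have hvq' := hvq.ne
  obtain ⟨H, hdeg, hadj⟩ := exists_switch G (a := v) (b := w) (c := c) (d := q) hwv hcq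
    hvw hwc (fun h => hqc h.symm) hvq.symm
  have hout : ∀ x y, x ∉ Q → y ∉ Q → (H.Adj x y ↔ G.Adj x y) := by
    intro x y hx hy
    rw [hadj]
    grind
  have hH : CliqueOptimal H v Q := by
    refine hG.of_deg_eq hdeg ?_ ?_
    · intro x hx y hy hxy
      have := hG.1 hx hy hxy
      rw [Finset.mem_coe] at hx hy
      rw [hadj]
      grind
    · have e : missing H v Q = insert q ((missing G v Q).erase w) := by
        ext x
        simp only [missing, Finset.mem_filter, Finset.mem_insert, Finset.mem_erase, hadj]
        grind
      rw [e, Finset.card_insert_of_notMem (by simp [missing, hvq]),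
        Finset.card_erase_add_one (by simp [missing, hw, hvw])]
  have h := hH.mem_coreNbrs hv ha ((hout _ _ hv ha).mpr hva) hb ((hout _ _ hv hb).mpr hvb) hab
    (fun h => nab ((hout _ _ ha hb).mp h)) hq (by rw [hadj]; grind) hr (by rw [hadj]; grind)
  rw [_root_.mem_coreNbrs] at h ⊢
  exact ⟨hr, (hout _ _ hv hr).mp h.2.1, fun u hu hvu hru =>
    (hout _ _ hr hu).mp (h.2.2 u hu ((hout _ _ hv hu).mpr hvu) hru)⟩

/-- If `Q` is an optimal clique of `m` vertices for `v`, then `G` has a clique of `m + 1` vertices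
as soon as `v` has degree at least `2 * m - 1` and some `d ≥ m` separates the degrees of the
vertices of `Q` from those of the remaining vertices. -/
theorem CliqueOptimal.exists_isClique {V : Type} [Fintype V] {G : SimpleGraph V} {v : V}
    {Q : Finset V} (hG : CliqueOptimal G v Q) (hv : v ∉ Q) {m d : ℕ} (hm : Q.card = m)
    (hdv : 2 * m ≤ deg G v + 1) (hmd : m ≤ d) (hd : ∀ q ∈ Q, d ≤ deg G q)
    (hd' : ∀ z, z ∉ Q → z ≠ v → deg G z ≤ d) :
    ∃ K : Finset V, G.IsClique (K : Set V) ∧ K.card = m + 1 := by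
  have insert_clique : ∀ K : Finset V, K.card = m → v ∉ K → G.IsClique (K : Set V) →
      (∀ x ∈ K, G.Adj v x) → ∃ K : Finset V, G.IsClique (K : Set V) ∧ K.card = m + 1 := by
    intro K hK hvK hKc hadj
    refine ⟨insert v K, ?_, by rw [Finset.card_insert_of_notMem hvK, hK]⟩
    rw [Finset.coe_insert, SimpleGraph.isClique_insert]
    exact ⟨hKc, fun x hx _ => hadj x hx⟩
  by_cases hfull : ∀ q ∈ Q, G.Adj v q
  · exact insert_clique Q hm hv hG.1 hfull
  push Not at hfull
  obtain ⟨w, hw, hvw⟩ := hfull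
  set D : Finset V := Finset.univ.filter fun u => u ∉ Q ∧ G.Adj v u with hD
  set S := coreNbrs G v Q with hS
  have hSD : S ⊆ D := by
    intro x hx
    have := _root_.mem_coreNbrs.mp hx
    simp [hD, this.1, this.2.1]
  have split : ∀ x, (Finset.univ.filter fun u => u ∉ Q ∧ G.Adj x u).card +
      (Q.filter (G.Adj x)).card = deg G x := by
    intro x
    rw [deg_eq_card_filter, ← Finset.card_union_of_disjoint]
    · congr 1
      ext u
      simp only [Finset.mem_union, Finset.mem_filter, Finset.mem_univ, true_and]
      tauto
    · rw [Finset.disjoint_left]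
      intro u
      simp only [Finset.mem_filter]
      tauto
  have hDcard : m ≤ D.card := by
    have h1 : D.card + (Q.filter (G.Adj v)).card = deg G v := split v
    have h2 : (Q.filter (G.Adj v)).card < m := by
      rw [← hm]
      exact Finset.card_lt_card (Finset.filter_ssubset.mpr ⟨w, hw, hvw⟩)
    omega
  have hm0 : 0 < m := hm ▸ Finset.card_pos.mpr ⟨w, hw⟩
  by_cases hScard : m - 1 ≤ S.card
  · obtain ⟨S', hS', hS'card⟩ := Finset.exists_subset_card_eq hScard
    obtain ⟨u, hu, huS⟩ := Finset.exists_mem_notMem_of_card_lt_card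
      (show S'.card < D.card by omega)
    have hDmem : ∀ x, x ∈ D ↔ x ∉ Q ∧ G.Adj v x := by simp [hD]
    have hins : ∀ x ∈ insert u S', G.Adj v x := by
      intro x hx
      rcases Finset.mem_insert.mp hx with rfl | hx
      · exact ((hDmem x).mp hu).2
      · exact ((hDmem x).mp (hSD (hS' hx))).2
    refine insert_clique (insert u S') (by rw [Finset.card_insert_of_notMem huS]; omega)
      (fun h => (hins v h).ne rfl) ?_ hins
    rw [Finset.coe_insert, SimpleGraph.isClique_insert]
    have hSadj : ∀ x ∈ S', ∀ y ∈ D, x ≠ y → G.Adj x y := by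
      intro x hx y hy hxy
      exact (_root_.mem_coreNbrs.mp (hS' hx)).2.2 y ((hDmem y).mp hy).1 ((hDmem y).mp hy).2 hxy
    exact ⟨fun x hx y hy hxy => hSadj x hx y (hSD (hS' hy)) hxy,
      fun x hx hux => (hSadj x hx u hu hux.symm).symm⟩
  exfalso
  obtain ⟨a, b, ha, hb, hab, nab⟩ : ∃ a b, a ∈ D ∧ b ∈ D ∧ a ≠ b ∧ ¬ G.Adj a b := by
    by_contra! h
    apply hScard
    have : D ⊆ S := by
      intro x hx
      rw [hS, _root_.mem_coreNbrs]
      have hx' := hx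
      simp only [hD, Finset.mem_filter, Finset.mem_univ, true_and] at hx'
      exact ⟨hx'.1, hx'.2, fun u hu hvu hxu => h x u hx (by simp [hD, hu, hvu]) hxu⟩
    have := Finset.card_le_card this
    omega
  simp only [hD, Finset.mem_filter, Finset.mem_univ, true_and] at ha hb
  set C : Finset V := Finset.univ.filter fun u => u ∉ Q ∧ G.Adj w u with hC
  have hCS : C ⊆ S := by
    intro c hc
    simp only [hC, Finset.mem_filter, Finset.mem_univ, true_and] at hc
    exact hG.mem_coreNbrs hv ha.1 ha.2 hb.1 hb.2 hab nab hw hvw hc.1 hc.2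
  have hQcard : ∀ q ∈ Q,
      d - m + 1 ≤ (Finset.univ.filter fun u => u ∉ Q ∧ G.Adj q u).card := by
    intro q hq
    have h1 := split q
    have h2 : (Q.filter (G.Adj q)).card < m := by
      rw [← hm]
      exact Finset.card_lt_card (Finset.filter_ssubset.mpr ⟨q, hq, by simp⟩)
    have := hd q hq
    omega
  have hlow : ∀ q ∈ Q, d - m ≤ (S.filter (G.Adj q)).card := by
    intro q hq
    have hqc := hQcard q hq
    by_cases h : ∀ c ∈ C, G.Adj q c
    · have h1 : C ⊆ S.filter (G.Adj q) := fun c hc => Finset.mem_filter.mpr ⟨hCS hc, h c hc⟩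
      have := Finset.card_le_card h1
      have : d - m + 1 ≤ C.card := hQcard w hw
      omega
    · push Not at h
      obtain ⟨c, hc, hqc'⟩ := h
      simp only [hC, Finset.mem_filter, Finset.mem_univ, true_and] at hc
      have h1 : (Finset.univ.filter fun u => u ∉ Q ∧ G.Adj q u).erase v ⊆
          S.filter (G.Adj q) := by
        intro r hr
        simp only [Finset.mem_erase, Finset.mem_filter, Finset.mem_univ, true_and] at hr
        exact Finset.mem_filter.mpr ⟨hG.mem_coreNbrs_of_adj hv ha.1 ha.2 hb.1 hb.2 hab nab hw hvw
          hc.1 hc.2 hq hqc' hr.2.1 hr.1 hr.2.2, hr.2.2⟩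
      have h2 := Finset.card_le_card h1
      have h3 := Finset.pred_card_le_card_erase (a := v)
        (s := Finset.univ.filter fun u => u ∉ Q ∧ G.Adj q u)
      omega
  have hloww : d - m + 1 ≤ (S.filter (G.Adj w)).card := by
    refine (hQcard w hw).trans (Finset.card_le_card fun c hc => Finset.mem_filter.mpr ⟨hCS hc, ?_⟩)
    simp only [Finset.mem_filter] at hc
    exact hc.2.2
  have hup : ∀ c ∈ S, (Q.filter (G.Adj c)).card ≤ d - m := by
    intro c hc
    obtain ⟨hcQ, hvc, hcadj⟩ := _root_.mem_coreNbrs.mp hc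
    have h1 := split c
    have h2 := hd' c hcQ hvc.ne'
    have h3 : insert v (D.erase c) ⊆ Finset.univ.filter fun u => u ∉ Q ∧ G.Adj c u := by
      intro u hu
      simp only [Finset.mem_insert, Finset.mem_erase, hD, Finset.mem_filter, Finset.mem_univ,
        true_and] at hu ⊢
      rcases hu with rfl | hu
      · exact ⟨hv, hvc.symm⟩
      · exact ⟨hu.2.1, hcadj u hu.2.1 hu.2.2 (Ne.symm hu.1)⟩
    have h4 := Finset.card_le_card h3
    rw [Finset.card_insert_of_notMem (by simp [hD]), Finset.card_erase_add_one (hSD hc)] at h4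
    omega
  have hdouble : ∑ q ∈ Q, (S.filter (G.Adj q)).card = ∑ c ∈ S, (Q.filter (G.Adj c)).card := by
    simp only [Finset.card_filter]
    rw [Finset.sum_comm]
    simp only [G.adj_comm]
  have hlow' : m * (d - m) < ∑ q ∈ Q, (S.filter (G.Adj q)).card := by
    rw [← hm, ← smul_eq_mul, ← Finset.sum_const]
    refine Finset.sum_lt_sum (fun q hq => ?_) ⟨w, hw, ?_⟩
    · rw [hm]; exact hlow q hq
    · rw [hm]; exact hloww
  have hup' : ∑ c ∈ S, (Q.filter (G.Adj c)).card ≤ S.card * (d - m) := by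
    rw [← smul_eq_mul]
    exact Finset.sum_le_card_nsmul _ _ _ hup
  have : S.card * (d - m) ≤ m * (d - m) := Nat.mul_le_mul_right _ (by omega)
  omega

theorem exists_cliqueOptimal {V : Type} [Fintype V] (G : SimpleGraph V) (v : V) (Q : Finset V)
    (hQ : G.IsClique (Q : Set V)) :
    ∃ H : SimpleGraph V, (∀ x, deg H x = deg G x) ∧ CliqueOptimal H v Q := by
  obtain ⟨H, hH, hmin⟩ := Set.exists_min_image
    {H : SimpleGraph V | (∀ x, deg H x = deg G x) ∧ H.IsClique (Q : Set V)}
    (fun H => (missing H v Q).card) (Set.toFinite _) ⟨G, fun _ => rfl, hQ⟩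
  exact ⟨H, hH.1, hH.2, fun K hK hKQ => hmin K ⟨fun x => (hK x).trans (hH.1 x), hKQ⟩⟩

/-- The graph `G` with all edges at `v` removed. -/
def isolate {V : Type} (G : SimpleGraph V) (v : V) : SimpleGraph V where
  Adj x y := G.Adj x y ∧ x ≠ v ∧ y ≠ v
  symm := ⟨fun _ _ h => ⟨h.1.symm, h.2.2, h.2.1⟩⟩
  loopless := ⟨fun x h => G.loopless.irrefl x h.1⟩

theorem isolate_adj {V : Type} (G : SimpleGraph V) (v x y : V) :
    (isolate G v).Adj x y ↔ G.Adj x y ∧ x ≠ v ∧ y ≠ v :=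
  Iff.rfl

theorem deg_eq_deg_isolate_add {V : Type} [Fintype V] (G : SimpleGraph V) {v x : V} (hx : x ≠ v) :
    deg G x = deg (isolate G v) x + if G.Adj v x then 1 else 0 := by
  have e : Finset.univ.filter ((isolate G v).Adj x) = (Finset.univ.filter (G.Adj x)).erase v := by
    ext y
    simp only [Finset.mem_filter, Finset.mem_univ, true_and, Finset.mem_erase, isolate_adj]
    tauto
  rw [deg_eq_card_filter, deg_eq_card_filter, e]
  split_ifs with h
  · rw [Finset.card_erase_add_one (by simpa using h.symm)]
  · rw [Finset.erase_eq_of_notMem (by simpa using fun h' : G.Adj x v => h h'.symm), add_zero]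

/-- A realization of the degrees of `G` with the edges at `v` removed extends to one of the degrees
of `G`. -/
theorem exists_extend_isolate {V : Type} [Fintype V] (G H : SimpleGraph V) (v : V)
    (hH : ∀ x, deg H x = deg (isolate G v) x) :
    ∃ K : SimpleGraph V, (∀ x, deg K x = deg G x) ∧ H ≤ K := by
  have hv0 : ∀ y, ¬ H.Adj v y := by
    intro y hy
    have h1 : deg (isolate G v) v = 0 := by
      rw [deg_eq_card_filter]
      simp [isolate_adj]
    have h2 := hH v
    rw [h1, deg_eq_card_filter, Finset.card_eq_zero] at h2
    exact absurd (show y ∈ Finset.univ.filter (H.Adj v) by simpa using hy) (by simp [h2])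
  let K : SimpleGraph V :=
    { Adj := fun x y => H.Adj x y ∨ (G.Adj x y ∧ (x = v ∨ y = v))
      symm := ⟨fun x y h => h.imp (fun h => h.symm) fun h => ⟨h.1.symm, h.2.symm⟩⟩
      loopless := ⟨fun x h => h.elim (H.loopless.irrefl x) fun h => G.loopless.irrefl x h.1⟩ }
  have hKv : ∀ y, K.Adj v y ↔ G.Adj v y := by
    intro y
    simp [K, hv0]
  have hKH : isolate K v = H := by
    ext x y
    have h1 : H.Adj x y → x ≠ v := by rintro h rfl; exact hv0 y h
    have h2 : H.Adj x y → y ≠ v := by rintro h rfl; exact hv0 x h.symm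
    simp only [isolate_adj, K]
    tauto
  refine ⟨K, fun x => ?_, fun x y h => Or.inl h⟩
  by_cases hx : x = v
  · subst hx
    simp only [deg_eq_card_filter, hKv]
  · rw [deg_eq_deg_isolate_add K hx, deg_eq_deg_isolate_add G hx, hKH, hH]
    simp only [hKv]

/-- Among realizations of the degrees of `G` with an `m`-clique, one may choose the clique to have
the largest degrees, as measured by a function within one of the degree. -/
theorem exists_clique_top {V : Type} [Fintype V] (G : SimpleGraph V) (f : V → ℕ) (P : V → Prop)
    (hf : ∀ x, deg G x ≤ f x) (hf' : ∀ x, f x ≤ deg G x + 1 ∨ ¬ P x) (m : ℕ)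
    (h : ∃ H : SimpleGraph V, (∀ x, deg H x = deg G x) ∧
      ∃ Q : Finset V, H.IsClique (Q : Set V) ∧ Q.card = m) :
    ∃ H : SimpleGraph V, (∀ x, deg H x = deg G x) ∧
      ∃ Q : Finset V, H.IsClique (Q : Set V) ∧ Q.card = m ∧
        ∀ q ∈ Q, ∀ z, z ∉ Q → P z → f z ≤ f q := by
  obtain ⟨H₀, hH₀, Q₀, hQ₀, hm₀⟩ := h
  obtain ⟨⟨H, Q⟩, ⟨hH, hQ, hm⟩, hmax⟩ := Set.exists_max_image
    {p : SimpleGraph V × Finset V | (∀ x, deg p.1 x = deg G x) ∧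
      p.1.IsClique (p.2 : Set V) ∧ p.2.card = m}
    (fun p => ∑ q ∈ p.2, f q) (Set.toFinite _) ⟨(H₀, Q₀), hH₀, hQ₀, hm₀⟩
  refine ⟨H, hH, Q, hQ, hm, fun q hq z hz hPz => ?_⟩
  by_contra! hlt
  have hle : deg H q ≤ deg H z := by
    rw [hH, hH]
    have := hf q
    rcases hf' z with h | h
    · omega
    · exact absurd hPz h
  obtain ⟨K, hK, hKQ⟩ := exists_clique_exchange H Q hQ hq hz hle
  have hz' : z ∉ Q.erase q := fun h => hz (Finset.mem_of_mem_erase h)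
  have := hmax (K, insert z (Q.erase q)) ⟨fun x => (hK x).trans (hH x), hKQ, by
    rw [Finset.card_insert_of_notMem hz', Finset.card_erase_add_one hq]; exact hm⟩
  simp only [Finset.sum_insert hz'] at this
  have h2 := Finset.add_sum_erase Q f hq
  omega

/-- The graph form of the Yin–Li theorem, for cliques of `r + 2` vertices. -/
theorem exists_clique_of_degrees {V : Type} [Fintype V] (r : ℕ) : ∀ G : SimpleGraph V,
    (∀ j, 1 ≤ j → j ≤ r + 2 →
      j ≤ (Finset.univ.filter fun u => max (r + 1) (2 * r + 2 - j) ≤ deg G u).card) →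
    ∃ H : SimpleGraph V, (∀ x, deg H x = deg G x) ∧
      ∃ Q : Finset V, H.IsClique (Q : Set V) ∧ Q.card = r + 2 := by
  induction r with
  | zero =>
    intro G hP
    obtain ⟨u, hu⟩ := Finset.card_pos.mp (hP 1 le_rfl (by omega))
    simp only [Finset.mem_filter, Finset.mem_univ, true_and] at hu
    rw [deg_eq_card_filter] at hu
    obtain ⟨y, hy⟩ := Finset.card_pos.mp (show 0 < (Finset.univ.filter (G.Adj u)).card by omega)
    have hy : G.Adj u y := by simpa using hy
    refine ⟨G, fun _ => rfl, {u, y}, ?_, Finset.card_pair hy.ne⟩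
    rw [Finset.coe_pair, SimpleGraph.isClique_pair]
    exact fun _ => hy
  | succ r ih =>
    intro G hP
    obtain ⟨v, hv⟩ := Finset.card_pos.mp (hP 1 le_rfl (by omega))
    have hdv : 2 * (r + 2) ≤ deg G v + 1 := by
      have := (Finset.mem_filter.mp hv).2
      omega
    have hiso := fun x (hx : x ≠ v) => deg_eq_deg_isolate_add G hx
    obtain ⟨H', hH', Q, hQ, hQcard, htop⟩ := exists_clique_top (isolate G v) (deg G) (· ≠ v)
      (fun x => by
        by_cases hx : x = v
        · subst hx
          rw [deg_eq_card_filter (isolate G x)]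
          simp [isolate_adj]
        · rw [hiso x hx]; omega)
      (fun x => by
        by_cases hx : x = v
        · exact Or.inr (by simpa using hx)
        · refine Or.inl ?_
          rw [hiso x hx]; split_ifs <;> omega)
      (r + 2) (ih (isolate G v) (by
        intro j hj hj'
        have h1 := hP (j + 1) (by omega) (by omega)
        have h2 : (Finset.univ.filter fun u =>
            max (r + 1 + 1) (2 * (r + 1) + 2 - (j + 1)) ≤ deg G u).erase v ⊆
            Finset.univ.filter fun u => max (r + 1) (2 * r + 2 - j) ≤ deg (isolate G v) u := by
          intro u hu
          simp only [Finset.mem_erase, Finset.mem_filter, Finset.mem_univ, true_and] at hu ⊢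
          have := hiso u hu.1
          have := hu.2
          split_ifs at * <;> omega
        have h3 := Finset.card_le_card h2
        have h4 := Finset.pred_card_le_card_erase (a := v) (s := Finset.univ.filter fun u =>
            max (r + 1 + 1) (2 * (r + 1) + 2 - (j + 1)) ≤ deg G u)
        omega))
    have hvQ : v ∉ Q := by
      intro hvQ
      obtain ⟨y, hy, hyv⟩ := Finset.exists_mem_ne (show 1 < Q.card by omega) v
      have hadj := hQ hvQ hy hyv.symm
      have h1 := hH' v
      rw [deg_eq_card_filter, deg_eq_card_filter] at h1
      have h2 : 0 < (Finset.univ.filter (H'.Adj v)).card :=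
        Finset.card_pos.mpr ⟨y, by simpa using hadj⟩
      rw [h1] at h2
      simp [isolate_adj] at h2
    obtain ⟨K, hK, hle⟩ := exists_extend_isolate G H' v hH'
    obtain ⟨H, hH, hopt⟩ := exists_cliqueOptimal K v Q (hQ.mono hle)
    have hHG : ∀ x, deg H x = deg G x := fun x => (hH x).trans (hK x)
    obtain ⟨q₀, hq₀, hmin⟩ := Finset.exists_min_image Q (deg G)
      (Finset.card_pos.mp (by omega))
    have hd : r + 2 ≤ deg G q₀ := by
      by_contra! hlt
      have h1 := hP (r + 1 + 2) (by omega) le_rfl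
      have h2 : (Finset.univ.filter fun u =>
          max (r + 1 + 1) (2 * (r + 1) + 2 - (r + 1 + 2)) ≤ deg G u) ⊆
          insert v (Q.erase q₀) := by
        intro u hu
        simp only [Finset.mem_filter, Finset.mem_univ, true_and] at hu
        rw [Finset.mem_insert, Finset.mem_erase]
        by_contra! hne
        by_cases huq : u = q₀
        · subst huq; omega
        · have := htop q₀ hq₀ u (hne.2 huq) hne.1
          omega
      have h3 := Finset.card_le_card h2
      have h4 := Finset.card_insert_le v (Q.erase q₀)
      have h5 := Finset.card_erase_of_mem hq₀
      omega
    refine ⟨H, hHG, hopt.exists_isClique hvQ hQcard (by rw [hHG]; exact hdv) hd ?_ ?_⟩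
    · intro q hq
      rw [hHG]
      exact hmin q hq
    · intro z hz hzv
      rw [hHG]
      exact htop q₀ hq₀ z hz hzv

/-- Yin–Li (ii): if d_s ≥ s-1 and d_i ≥ 2s-2-i for 1 ≤ i ≤ s-1, then π is potentially
K_s-graphic. -/
theorem yin_li_ii {n s : ℕ} (hs : 1 ≤ s) (hn : s ≤ n)
    (π : Fin n → ℕ) (hmono : Antitone π) (hg : Graphic π)
    (h1 : s - 1 ≤ π ⟨s - 1, by omega⟩)
    (h2 : ∀ (i : ℕ) (hi1 : 1 ≤ i) (hi2 : i ≤ s - 1), 2 * s - 2 - i ≤ π ⟨i - 1, by omega⟩) :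
    PotentiallyGraphic π (⊤ : SimpleGraph (Fin s)) := by
  obtain ⟨G, hG⟩ := hg
  suffices h : ∃ H : SimpleGraph (Fin n), (∀ x, deg H x = deg G x) ∧
      ∃ Q : Finset (Fin n), H.IsClique (Q : Set (Fin n)) ∧ Q.card = s by
    obtain ⟨H, hH, Q, hQ, hcard⟩ := h
    refine ⟨H, fun i => (hH i).trans (hG i), (Q.orderEmbOfFin hcard).toEmbedding, ?_⟩
    intro x y hxy
    exact hQ (Q.orderEmbOfFin_mem hcard x) (Q.orderEmbOfFin_mem hcard y)
      fun h => hxy ((Q.orderEmbOfFin hcard).injective h)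
  obtain rfl | ⟨r, rfl⟩ : s = 1 ∨ ∃ r, s = r + 2 := by
    rcases Nat.lt_or_ge s 2 with h | h
    · exact Or.inl (by omega)
    · exact Or.inr ⟨s - 2, by omega⟩
  · exact ⟨G, fun _ => rfl, {⟨0, by omega⟩}, by simp, by simp⟩
  refine exists_clique_of_degrees r G fun j hj hj' => ?_
  have hsub : Finset.univ.image (Fin.castLE (show j ≤ n by omega)) ⊆
      Finset.univ.filter fun u => max (r + 1) (2 * r + 2 - j) ≤ deg G u := by
    intro u hu
    obtain ⟨i, -, rfl⟩ := Finset.mem_image.mp hu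
    have hi := i.2
    simp only [Finset.mem_filter, Finset.mem_univ, true_and, hG _]
    have hlast : π ⟨r + 2 - 1, by omega⟩ ≤ π (Fin.castLE (show j ≤ n by omega) i) :=
      hmono (by simp only [Fin.le_def, Fin.val_castLE]; omega)
    refine max_le (by omega) ?_
    by_cases hjr : j ≤ r + 1
    · have hi' := h2 j hj (by omega)
      have : π ⟨j - 1, by omega⟩ ≤ π (Fin.castLE (show j ≤ n by omega) i) :=
        hmono (by simp only [Fin.le_def, Fin.val_castLE]; omega)
      omega
    · omega
  have := Finset.card_le_card hsub
  rwa [Finset.card_image_of_injective _ (Fin.castLE_injective _), Finset.card_fin] at this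
end
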